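/- arXiv:1906.04371 — 2 statements merged into one kernel-verified Lean document; each statement's English description precedes it below -/
import Mathlib

section
/- Let n ≥ 2 be an integer. Under Assumption A, suppose in addition that α, k ∈ C^{n−1}([0,T]), that α(0) > 0, and that γ > 1/2 with ∑_{i=1}^∞ λ_i^{γ+2n} u_{0,i}² < ∞. Let u_i ∈ C¹([0,T]) solve u_i(0) = u_{0,i}, u_i'(t) + k(t)·D^{α(t)}u_i(t) = −λ_i u_i(t) on (0,T]. Then each u_i belongs to C^n((0,T]) and there is a constant Q > 0, independent of the data (u_{0,i}), such that sup_{t∈[0,T]} ∑_{i=1}^∞ λ_i^γ u_i(t)² ≤ Q² ∑_{i=1}^∞ λ_i^{γ+2n} u_{0,i}², sup_{t∈[0,T]} ∑_{i=1}^∞ λ_i^γ (u_i'(t))² ≤ Q² ∑_{i=1}^∞ λ_i^{γ+2n} u_{0,i}², and for every 2 ≤ l ≤ n, sup_{t∈(0,T]} t^{2(l−2+α(0))} ∑_{i=1}^∞ λ_i^γ (u_i^{(l)}(t))² ≤ Q² ∑_{i=1}^∞ λ_i^{γ+2n} u_{0,i}². -/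
open Real Set Filter

/-- Variable-order Caputo-type fractional derivative applied to a function with derivative `g'`. -/
noncomputable def caputo (α g' : ℝ → ℝ) (t : ℝ) : ℝ :=
  (1 / Real.Gamma (1 - α t)) * ∫ s in (0:ℝ)..t, g' s * (t - s) ^ (-(α t))

section EulerBound

variable {E F G : Type*} [NormedAddCommGroup E] [NormedSpace ℝ E]
  [NormedAddCommGroup F] [NormedSpace ℝ F] [NormedAddCommGroup G] [NormedSpace ℝ G]

/-- `EulerBound T m w f`: on `(0, T]` the iterates of order at most `m` of the Euler operator
`t ↦ t • f' t` applied to `f` exist, the last one is continuous, and all have norm at most `w`. -/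
def EulerBound (T : ℝ) : ℕ → (ℝ → ℝ) → (ℝ → E) → Prop
  | 0, w, f => (∀ t ∈ Ioc 0 T, ‖f t‖ ≤ w t) ∧ ContinuousOn f (Ioc 0 T)
  | m + 1, w, f => (∀ t ∈ Ioc 0 T, ‖f t‖ ≤ w t) ∧
      ∃ g : ℝ → E, (∀ t ∈ Ioc 0 T, HasDerivWithinAt f (t⁻¹ • g t) (Ioc 0 T) t) ∧
        EulerBound T m w g

namespace EulerBound

variable {T : ℝ} {m : ℕ} {w w₁ w₂ : ℝ → ℝ} {f f₁ f₂ : ℝ → E}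

lemma norm_le (h : EulerBound T m w f) {t : ℝ} (ht : t ∈ Ioc 0 T) : ‖f t‖ ≤ w t := by
  cases m with
  | zero => exact h.1 t ht
  | succ m => exact h.1 t ht

lemma continuousOn (h : EulerBound T m w f) : ContinuousOn f (Ioc 0 T) := by
  cases m with
  | zero => exact h.2
  | succ m =>
    obtain ⟨-, g, hg, -⟩ := h
    exact fun t ht => (hg t ht).continuousWithinAt

lemma mono (h : EulerBound T m w₁ f) (hw : ∀ t ∈ Ioc 0 T, w₁ t ≤ w₂ t) :
    EulerBound T m w₂ f := by
  induction m generalizing f with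
  | zero => exact ⟨fun t ht => (h.1 t ht).trans (hw t ht), h.2⟩
  | succ m ih =>
    obtain ⟨h1, g, hg, h2⟩ := h
    exact ⟨fun t ht => (h1 t ht).trans (hw t ht), g, hg, ih h2⟩

lemma congr (h : EulerBound T m w f₁) (hf : ∀ t ∈ Ioc 0 T, f₁ t = f₂ t) :
    EulerBound T m w f₂ := by
  cases m with
  | zero => exact ⟨fun t ht => hf t ht ▸ h.1 t ht, h.2.congr fun t ht => (hf t ht).symm⟩
  | succ m =>
    obtain ⟨h1, g, hg, h2⟩ := h
    exact ⟨fun t ht => hf t ht ▸ h1 t ht, g, fun t ht =>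
      (hg t ht).congr (fun x hx => (hf x hx).symm) (hf t ht).symm, h2⟩

lemma of_succ (h : EulerBound T (m + 1) w f) : EulerBound T m w f := by
  induction m generalizing f with
  | zero => exact ⟨h.1, h.continuousOn⟩
  | succ m ih =>
    obtain ⟨h1, g, hg, h2⟩ := h
    exact ⟨h1, g, hg, ih h2⟩

lemma of_le {m' : ℕ} (h : EulerBound T m w f) (hm : m' ≤ m) : EulerBound T m' w f := by
  induction m, hm using Nat.le_induction with
  | base => exact h
  | succ k _ ih => exact ih h.of_succ

lemma add (h₁ : EulerBound T m w₁ f₁) (h₂ : EulerBound T m w₂ f₂) :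
    EulerBound T m (fun t => w₁ t + w₂ t) (fun t => f₁ t + f₂ t) := by
  induction m generalizing f₁ f₂ with
  | zero => exact ⟨fun t ht => norm_add_le_of_le (h₁.1 t ht) (h₂.1 t ht), h₁.2.add h₂.2⟩
  | succ m ih =>
    obtain ⟨h1, g, hg, h1'⟩ := h₁
    obtain ⟨h2, k, hk, h2'⟩ := h₂
    refine ⟨fun t ht => norm_add_le_of_le (h1 t ht) (h2 t ht), _, fun t ht => ?_, ih h1' h2'⟩
    simpa only [smul_add] using (hg t ht).fun_add (hk t ht)

lemma clm_comp (h : EulerBound T m w f) (L : E →L[ℝ] F) :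
    EulerBound T m (fun t => ‖L‖ * w t) (fun t => L (f t)) := by
  induction m generalizing f with
  | zero =>
    exact ⟨fun t ht => L.le_opNorm_of_le (h.1 t ht), L.continuous.comp_continuousOn h.2⟩
  | succ m ih =>
    obtain ⟨h1, g, hg, h1'⟩ := h
    refine ⟨fun t ht => L.le_opNorm_of_le (h1 t ht), _, fun t ht => ?_, ih h1'⟩
    simpa only [map_smul, Function.comp_def] using
      L.hasFDerivAt.comp_hasDerivWithinAt t (hg t ht)

lemma const (c : E) : EulerBound T m (fun _ => ‖c‖) (fun _ => c) := by
  suffices H : ∀ m, ∀ c' : E, ‖c'‖ ≤ ‖c‖ → EulerBound T m (fun _ => ‖c‖) (fun _ => c') from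
    H m c le_rfl
  intro m
  induction m with
  | zero => exact fun c' hc' => ⟨fun t _ => hc', continuousOn_const⟩
  | succ m ih =>
    refine fun c' hc' => ⟨fun t _ => hc', fun _ => 0, fun t _ => ?_, ih 0 (by simp)⟩
    simpa using hasDerivWithinAt_const t (Ioc 0 T) c'

lemma bilin {g : ℝ → F} (B : E →L[ℝ] F →L[ℝ] G) (hB : ‖B‖ ≤ 1)
    (h₁ : EulerBound T m w₁ f) (h₂ : EulerBound T m w₂ g) :
    EulerBound T m (fun t => 2 ^ m * (w₁ t * w₂ t)) (fun t => B (f t) (g t)) := by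
  have key : ∀ {x : E} {y : F} {a b : ℝ}, ‖x‖ ≤ a → ‖y‖ ≤ b → ‖B x y‖ ≤ a * b := by
    intro x y a b hx hy
    calc ‖B x y‖ ≤ ‖B‖ * ‖x‖ * ‖y‖ := B.le_opNorm₂ x y
      _ ≤ 1 * ‖x‖ * ‖y‖ := by gcongr
      _ ≤ a * b := by
        rw [one_mul]; exact mul_le_mul hx hy (norm_nonneg _) ((norm_nonneg _).trans hx)
  induction m generalizing f g with
  | zero =>
    refine ⟨fun t ht => by simpa using key (h₁.1 t ht) (h₂.1 t ht), ?_⟩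
    exact (B.continuous.comp_continuousOn h₁.2).clm_apply h₂.2
  | succ m ih =>
    obtain ⟨h1, f', hf', h1'⟩ := id h₁
    obtain ⟨h2, g', hg', h2'⟩ := id h₂
    refine ⟨fun t ht => (key (h1 t ht) (h2 t ht)).trans ?_,
      fun t => B (f t) (g' t) + B (f' t) (g t), fun t ht => ?_, ?_⟩
    · have : 0 ≤ w₁ t * w₂ t :=
        mul_nonneg ((norm_nonneg _).trans (h1 t ht)) ((norm_nonneg _).trans (h2 t ht))
      exact le_mul_of_one_le_left this (one_le_pow₀ (by norm_num))
    · have := B.hasDerivWithinAt_of_bilinear (hf' t ht) (hg' t ht)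
      simpa only [map_smul, smul_add, smul_apply] using this
    · refine ((ih h₁.of_succ h2').add (ih h1' h₂.of_succ)).mono fun t _ => le_of_eq ?_
      ring

lemma mul {A : Type*} [NormedRing A] [NormedAlgebra ℝ A] {f g : ℝ → A}
    (h₁ : EulerBound T m w₁ f) (h₂ : EulerBound T m w₂ g) :
    EulerBound T m (fun t => 2 ^ m * (w₁ t * w₂ t)) (fun t => f t * g t) :=
  bilin (ContinuousLinearMap.mul ℝ A) (ContinuousLinearMap.opNorm_mul_le ℝ A) h₁ h₂

lemma smul {a : ℝ → ℝ} (h₁ : EulerBound T m w₁ a) (h₂ : EulerBound T m w₂ f) :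
    EulerBound T m (fun t => 2 ^ m * (w₁ t * w₂ t)) (fun t => a t • f t) :=
  bilin (ContinuousLinearMap.lsmul ℝ ℝ) ContinuousLinearMap.opNorm_lsmul_le h₁ h₂

lemma clm_apply {L : ℝ → E →L[ℝ] F} (h₁ : EulerBound T m w₁ L) (h₂ : EulerBound T m w₂ f) :
    EulerBound T m (fun t => 2 ^ m * (w₁ t * w₂ t)) (fun t => L t (f t)) :=
  bilin (ContinuousLinearMap.id ℝ (E →L[ℝ] F)) ContinuousLinearMap.norm_id_le h₁ h₂

lemma inv_real : EulerBound T m (fun t => t⁻¹) (fun t : ℝ => t⁻¹) := by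
  suffices H : ∀ m, ∀ c : ℝ, |c| ≤ 1 → EulerBound T m (fun t => t⁻¹) (fun t : ℝ => c * t⁻¹) by
    simpa using H m 1 (by simp)
  have hn : ∀ c : ℝ, |c| ≤ 1 → ∀ t ∈ Ioc 0 T, ‖c * t⁻¹‖ ≤ t⁻¹ := fun c hc t ht => by
    have := inv_pos.2 ht.1
    rw [norm_mul, Real.norm_of_nonneg this.le, Real.norm_eq_abs]
    exact mul_le_of_le_one_left this.le hc
  intro m
  induction m with
  | zero =>
    exact fun c hc => ⟨hn c hc, continuousOn_const.mul
      (continuousOn_inv₀.mono fun t ht => ht.1.ne')⟩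
  | succ m ih =>
    refine fun c hc => ⟨hn c hc, _, fun t ht => ?_, ih (-c) (by simpa using hc)⟩
    convert ((hasDerivAt_inv ht.1.ne').const_mul c).hasDerivWithinAt using 1
    have := ht.1.ne'
    simp only [smul_eq_mul]
    field_simp

/-- Inversion of a perturbation of the identity of norm at most `1 / 2`. -/
lemma ringInverse {A : Type*} [NormedRing A] [NormedAlgebra ℝ A] [CompleteSpace A]
    {S : ℝ → A} {C : ℝ} (hS : EulerBound T m (fun _ => C) S)
    (hsmall : ∀ t ∈ Ioc 0 T, ‖S t‖ ≤ 1 / 2) :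
    ∃ D, EulerBound T m (fun _ => D) (fun t => Ring.inverse (1 + S t)) := by
  have hunit : ∀ t ∈ Ioc 0 T, IsUnit (1 + S t) := fun t ht => by
    have := isUnit_one_sub_of_norm_lt_one (x := -S t)
      (by rw [norm_neg]; linarith [hsmall t ht])
    simpa using this
  have hbd : ∀ t ∈ Ioc 0 T, ‖Ring.inverse (1 + S t)‖ ≤ 2 * ‖(1 : A)‖ := fun t ht => by
    have h1 : Ring.inverse (1 + S t) = 1 - Ring.inverse (1 + S t) * S t := by
      have := Ring.inverse_mul_cancel _ (hunit t ht)
      rw [mul_add, mul_one] at this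
      exact eq_sub_of_add_eq this
    have h2 : ‖Ring.inverse (1 + S t)‖ ≤ ‖(1 : A)‖ + ‖Ring.inverse (1 + S t)‖ * (1 / 2) := by
      conv_lhs => rw [h1]
      refine (norm_sub_le _ _).trans (add_le_add_right ((norm_mul_le _ _).trans ?_) _)
      exact mul_le_mul_of_nonneg_left (hsmall t ht) (norm_nonneg _)
    linarith
  have hder : ∀ {S' : A} {t : ℝ}, t ∈ Ioc 0 T → HasDerivWithinAt S S' (Ioc 0 T) t →
      HasDerivWithinAt (fun t => Ring.inverse (1 + S t))
        (-(Ring.inverse (1 + S t) * S' * Ring.inverse (1 + S t))) (Ioc 0 T) t := by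
    intro S' t ht h
    obtain ⟨x, hx⟩ := hunit t ht
    have h1 := hasFDerivAt_ringInverse (𝕜 := ℝ) x
    have h2 : HasDerivWithinAt (fun t => 1 + S t) S' (Ioc 0 T) t := h.const_add 1
    rw [hx] at h1
    have h3 := h1.comp_hasDerivWithinAt t h2
    rw [← hx, Ring.inverse_unit]
    simpa [Function.comp_def] using h3
  induction m with
  | zero =>
    refine ⟨_, hbd, fun t ht => ?_⟩
    obtain ⟨x, hx⟩ := hunit t ht
    have h1 := NormedRing.inverse_continuousAt x
    rw [hx] at h1
    exact h1.comp_continuousWithinAt (f := fun t => 1 + S t)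
      (continuousWithinAt_const.add (hS.2 t ht))
  | succ m ih =>
    obtain ⟨D, hD⟩ := ih hS.of_succ
    obtain ⟨-, S', hS', hS2⟩ := hS
    have h4 := ((hD.mul hS2).mul hD).clm_comp (-ContinuousLinearMap.id ℝ A)
    refine ⟨max (2 * ‖(1 : A)‖) (‖-ContinuousLinearMap.id ℝ A‖ *
      (2 ^ m * (2 ^ m * (D * C) * D))), fun t ht => (hbd t ht).trans (le_max_left _ _),
      _, fun t ht => ?_, h4.mono fun t _ => le_max_right _ _⟩
    simpa using hder ht (hS' t ht)

lemma iteratedDerivWithin_bound {f : ℝ → E} (h : EulerBound T m w f) :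
    ContDiffOn ℝ m f (Ioc 0 T) ∧ ∀ j ≤ m, ∀ t ∈ Ioc 0 T,
      ‖iteratedDerivWithin j f (Ioc 0 T) t‖ ≤ 2 ^ (m * j) * (w t * (t⁻¹) ^ j) := by
  have hu : UniqueDiffOn ℝ (Ioc 0 T) := uniqueDiffOn_Ioc 0 T
  induction m generalizing f w with
  | zero =>
    refine ⟨contDiffOn_zero.2 h.2, fun j hj t ht => ?_⟩
    obtain rfl : j = 0 := by omega
    simpa using h.1 t ht
  | succ m ih =>
    obtain ⟨h1, g, hg, h2⟩ := h
    obtain ⟨i1, i2⟩ := ih (inv_real.smul h2)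
    have hd : ∀ t ∈ Ioc 0 T, derivWithin f (Ioc 0 T) t = t⁻¹ • g t :=
      fun t ht => (hg t ht).derivWithin (hu t ht)
    refine ⟨?_, fun j hj t ht => ?_⟩
    · push_cast
      rw [contDiffOn_succ_iff_derivWithin hu]
      exact ⟨fun t ht => (hg t ht).differentiableWithinAt, by simp, i1.congr hd⟩
    · cases j with
      | zero => simpa using h1 t ht
      | succ j =>
        rw [iteratedDerivWithin_succ', iteratedDerivWithin_congr hd ht]
        have hw : 0 ≤ w t := (norm_nonneg _).trans (h1 t ht)
        have ht0 : 0 < t⁻¹ := inv_pos.2 ht.1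
        refine (i2 j (by omega) t ht).trans ?_
        calc (2:ℝ) ^ (m * j) * (2 ^ m * (t⁻¹ * w t) * t⁻¹ ^ j)
            = 2 ^ (m * j + m) * (w t * t⁻¹ ^ (j + 1)) := by ring
          _ ≤ 2 ^ ((m + 1) * (j + 1)) * (w t * t⁻¹ ^ (j + 1)) := by
            gcongr
            · norm_num
            · nlinarith

end EulerBound

end EulerBound

section Dilation

variable {K : Type*} {T : ℝ} {p : K → ℝ}

lemma dilation_mem (hp01 : ∀ x, p x ∈ Icc (0:ℝ) 1) {s : ℝ} (hs : s ∈ Ioc 0 T) (x : K) :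
    s * p x ∈ Icc 0 T :=
  ⟨mul_nonneg hs.1.le (hp01 x).1,
    (mul_le_of_le_one_right hs.1.le (hp01 x).2).trans hs.2⟩

lemma hasDerivWithinAt_dilation (hp01 : ∀ x, p x ∈ Icc (0:ℝ) 1) {f : ℝ → ℝ} {f' s : ℝ}
    {x : K} (hs : s ∈ Ioc 0 T) (hf : HasDerivWithinAt f f' (Icc 0 T) (s * p x)) :
    HasDerivWithinAt (fun s => f (s * p x)) (s⁻¹ * (s * p x * f')) (Ioc 0 T) s := by
  have h1 : HasDerivWithinAt (fun s => s * p x) (1 * p x) (Ioc 0 T) s :=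
    (hasDerivWithinAt_id s _).mul_const _
  have h2 := hf.comp s h1 fun r hr => dilation_mem hp01 hr x
  refine h2.congr_deriv ?_
  have := hs.1.ne'
  field_simp

variable [TopologicalSpace K]

lemma continuousOn_dilation (hp : Continuous p) (hp01 : ∀ x, p x ∈ Icc (0:ℝ) 1) {f : ℝ → ℝ}
    (hf : ContinuousOn f (Icc 0 T)) :
    ContinuousOn (Function.uncurry fun s x => f (s * p x)) (Ioc 0 T ×ˢ univ) := by
  refine hf.comp (f := fun q : ℝ × K => q.1 * p q.2) (by fun_prop) fun q hq => ?_
  exact dilation_mem hp01 hq.1 q.2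

lemma continuous_dilation (hp : Continuous p) (hp01 : ∀ x, p x ∈ Icc (0:ℝ) 1) {f : ℝ → ℝ}
    (hf : ContinuousOn f (Icc 0 T)) {s : ℝ} (hs : s ∈ Ioc 0 T) :
    Continuous fun x => f (s * p x) :=
  hf.comp_continuous (by fun_prop) fun x => dilation_mem hp01 hs x

end Dilation

section ParamBound

variable {K : Type*} [TopologicalSpace K] [CompactSpace K]

/-- `ParamBound T m w f`: the `K`-indexed family of functions `f · x` satisfies
`EulerBound T m w` uniformly, as a function with values in `C(K, ℝ)`. -/
def ParamBound (T : ℝ) (m : ℕ) (w : ℝ → ℝ) (f : ℝ → K → ℝ) : Prop :=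
  ∃ F : ℝ → C(K, ℝ), EulerBound T m w F ∧ ∀ s ∈ Ioc 0 T, ∀ x, F s x = f s x

namespace ParamBound

variable {T : ℝ} {m : ℕ} {w w₁ w₂ : ℝ → ℝ} {f f₁ f₂ g : ℝ → K → ℝ}

lemma mono (h : ParamBound T m w₁ f) (hw : ∀ t ∈ Ioc 0 T, w₁ t ≤ w₂ t) :
    ParamBound T m w₂ f := by
  obtain ⟨F, hF, hf⟩ := h
  exact ⟨F, hF.mono hw, hf⟩

lemma congr (h : ParamBound T m w f₁) (hf : ∀ t ∈ Ioc 0 T, ∀ x, f₁ t x = f₂ t x) :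
    ParamBound T m w f₂ := by
  obtain ⟨F, hF, hF'⟩ := h
  exact ⟨F, hF, fun s hs x => (hF' s hs x).trans (hf s hs x)⟩

lemma add (h₁ : ParamBound T m w₁ f₁) (h₂ : ParamBound T m w₂ f₂) :
    ParamBound T m (fun t => w₁ t + w₂ t) (fun t x => f₁ t x + f₂ t x) := by
  obtain ⟨F, hF, hF'⟩ := h₁
  obtain ⟨G, hG, hG'⟩ := h₂
  exact ⟨_, hF.add hG, fun s hs x => by simp [hF' s hs x, hG' s hs x]⟩

lemma mul (h₁ : ParamBound T m w₁ f₁) (h₂ : ParamBound T m w₂ f₂) :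
    ParamBound T m (fun t => 2 ^ m * (w₁ t * w₂ t)) (fun t x => f₁ t x * f₂ t x) := by
  obtain ⟨F, hF, hF'⟩ := h₁
  obtain ⟨G, hG, hG'⟩ := h₂
  exact ⟨_, hF.mul hG, fun s hs x => by simp [hF' s hs x, hG' s hs x]⟩

lemma neg (h : ParamBound T m w f) : ParamBound T m w (fun t x => -f t x) := by
  obtain ⟨F, hF, hF'⟩ := h
  refine ⟨_, (hF.clm_comp (-ContinuousLinearMap.id ℝ _)).mono fun t ht => ?_,
    fun s hs x => by simp [hF' s hs x]⟩
  rw [norm_neg]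
  exact mul_le_of_le_one_left ((norm_nonneg _).trans (hF.norm_le ht))
    ContinuousLinearMap.norm_id_le

lemma exists_const (c : C(K, ℝ)) : ParamBound T m (fun _ => ‖c‖) (fun _ x => c x) :=
  ⟨_, EulerBound.const c, fun _ _ _ => rfl⟩

lemma zero (hf : ContinuousOn (Function.uncurry f) (Ioc 0 T ×ˢ univ))
    (hw : ∀ t ∈ Ioc 0 T, ∀ x, |f t x| ≤ w t) (hw0 : ∀ t ∈ Ioc 0 T, 0 ≤ w t) :
    ParamBound T 0 w f := by
  classical
  have hc : ∀ s ∈ Ioc 0 T, Continuous (f s) := fun s hs =>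
    hf.comp_continuous (f := fun x => (s, x)) (by fun_prop) fun x => ⟨hs, trivial⟩
  refine ⟨fun s => if h : Continuous (f s) then ⟨f s, h⟩ else 0, ⟨fun t ht => ?_, ?_⟩,
    fun s hs x => by simp [hc s hs]⟩
  · simp only [dif_pos (hc t ht)]
    exact (ContinuousMap.norm_le _ (hw0 t ht)).2 fun x => hw t ht x
  · rw [continuousOn_iff_continuous_domRestrict]
    refine ContinuousMap.continuous_of_continuous_uncurry _ ?_
    have := hf.comp_continuous (f := fun p : Ioc 0 T × K => ((p.1 : ℝ), p.2)) (by fun_prop)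
      fun p => ⟨p.1.2, trivial⟩
    convert this using 1
    ext p
    simp [Function.uncurry, hc p.1 p.1.2]

lemma _root_.ContinuousMap.hasDerivWithinAt_of_pointwise {F G : ℝ → C(K, ℝ)}
    (hd : ∀ t ∈ Ioc 0 T, ∀ x, HasDerivWithinAt (F · x) (t⁻¹ * G t x) (Ioc 0 T) t)
    (hG : ContinuousOn G (Ioc 0 T)) {t : ℝ} (ht : t ∈ Ioc 0 T) :
    HasDerivWithinAt F (t⁻¹ • G t) (Ioc 0 T) t := by
  rw [hasDerivWithinAt_iff_isLittleO, Asymptotics.isLittleO_iff]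
  intro ε hε
  have hcont : ContinuousWithinAt (fun s => s⁻¹ • G s) (Ioc 0 T) t :=
    (continuousAt_inv₀ ht.1.ne').continuousWithinAt.smul (hG t ht)
  obtain ⟨δ, hδ, hδ'⟩ := Metric.continuousWithinAt_iff.1 hcont ε hε
  filter_upwards [inter_mem_nhdsWithin (Ioc 0 T) (Metric.ball_mem_nhds t hδ)] with s hs
  refine (ContinuousMap.norm_le _ (by positivity)).2 fun x => ?_
  have key := Convex.norm_image_sub_le_of_norm_hasDerivWithin_le (𝕜 := ℝ)
    (s := Ioc 0 T ∩ Metric.ball t δ) (f := fun r => F r x - r * (t⁻¹ * G t x))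
    (f' := fun r => r⁻¹ * G r x - 1 * (t⁻¹ * G t x)) (C := ε) (x := t) (y := s)
    (fun r hr => ((hd r hr.1 x).mono inter_subset_left).fun_sub
      ((hasDerivWithinAt_id r _).mul_const _))
    (fun r hr => by
      have h1 := (hδ' hr.1 hr.2).le
      rw [dist_eq_norm] at h1
      simpa using (ContinuousMap.norm_coe_le_norm _ x).trans h1)
    ((convex_Ioc 0 T).inter (convex_ball t δ)) ⟨ht, Metric.mem_ball_self hδ⟩ hs
  refine le_of_eq_of_le (congrArg norm ?_) key
  simp
  ring

lemma succ (hc : ∀ t ∈ Ioc 0 T, Continuous (f t))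
    (hw : ∀ t ∈ Ioc 0 T, ∀ x, |f t x| ≤ w t) (hw0 : ∀ t ∈ Ioc 0 T, 0 ≤ w t)
    (hd : ∀ t ∈ Ioc 0 T, ∀ x, HasDerivWithinAt (f · x) (t⁻¹ * g t x) (Ioc 0 T) t)
    (hg : ParamBound T m w g) : ParamBound T (m + 1) w f := by
  classical
  obtain ⟨G, hG, hG'⟩ := hg
  set F : ℝ → C(K, ℝ) := fun s => if h : Continuous (f s) then ⟨f s, h⟩ else 0 with hF
  have hFf : ∀ s ∈ Ioc 0 T, ∀ x, F s x = f s x := fun s hs x => by simp [hF, hc s hs]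
  refine ⟨F, ⟨fun t ht => (ContinuousMap.norm_le _ (hw0 t ht)).2 fun x => ?_, G, fun t ht =>
    ContinuousMap.hasDerivWithinAt_of_pointwise (fun s hs x => ?_) hG.continuousOn ht, hG⟩, hFf⟩
  · rw [hFf t ht]
    exact hw t ht x
  · rw [hG' s hs]
    exact (hd s hs x).congr (fun r hr => hFf r hr x) (hFf s hs x)

end ParamBound

section Dilation

variable {T : ℝ} {p : K → ℝ}

lemma paramBound_dilation_id (hp : Continuous p) (hp01 : ∀ x, p x ∈ Icc (0:ℝ) 1) (m : ℕ) :
    ParamBound T m (fun s => s) (fun s x => s * p x) := by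
  have hw : ∀ t ∈ Ioc 0 T, ∀ x, |t * p x| ≤ t := fun t ht x => by
    rw [abs_of_nonneg (dilation_mem hp01 ht x).1]
    exact mul_le_of_le_one_right ht.1.le (hp01 x).2
  induction m with
  | zero => exact .zero (by simp only [Function.uncurry_def]; fun_prop) hw fun t ht => ht.1.le
  | succ m ih =>
    refine .succ (fun t _ => by fun_prop) hw (fun t ht => ht.1.le) (fun t ht x => ?_) ih
    simpa using hasDerivWithinAt_dilation hp01 (f := fun t => t) ht (hasDerivWithinAt_id _ _)

lemma exists_paramBound_dilation (hT : 0 < T) (hp : Continuous p)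
    (hp01 : ∀ x, p x ∈ Icc (0:ℝ) 1) {m : ℕ} {f : ℝ → ℝ} (hf : ContDiffOn ℝ m f (Icc 0 T)) :
    ∃ C, ParamBound T m (fun _ => C) (fun s x => f (s * p x)) := by
  induction m generalizing f with
  | zero =>
    obtain ⟨C, hC⟩ := isCompact_Icc.exists_bound_of_continuousOn hf.continuousOn
    refine ⟨C, .zero (continuousOn_dilation hp hp01 hf.continuousOn)
      (fun t ht x => hC _ (dilation_mem hp01 ht x)) fun t ht =>
        (norm_nonneg _).trans (hC T ⟨hT.le, le_rfl⟩)⟩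
  | succ m ih =>
    obtain ⟨C, hC⟩ := isCompact_Icc.exists_bound_of_continuousOn hf.continuousOn
    have hC0 := (norm_nonneg _).trans (hC T ⟨hT.le, le_rfl⟩)
    push_cast at hf
    rw [contDiffOn_succ_iff_derivWithin (uniqueDiffOn_Icc hT)] at hf
    obtain ⟨D, hD⟩ := ih hf.2.2
    have hD2 := (paramBound_dilation_id (T := T) hp hp01 m).mul hD
    refine ⟨max C (2 ^ m * (T * |D|)), .succ
      (fun t ht => continuous_dilation hp hp01 hf.1.continuousOn ht)
      (fun t ht x => (hC _ (dilation_mem hp01 ht x)).trans (le_max_left _ _))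
      (fun t ht => hC0.trans (le_max_left _ _))
      (fun t ht x => hasDerivWithinAt_dilation hp01 ht
        (hf.1 _ (dilation_mem hp01 ht x)).hasDerivWithinAt)
      (hD2.mono fun t ht => le_trans ?_ (le_max_right _ _))⟩
    have h1 : t * D ≤ T * |D| :=
      (mul_le_mul_of_nonneg_left (le_abs_self D) ht.1.le).trans
        (mul_le_mul_of_nonneg_right ht.2 (abs_nonneg D))
    gcongr

lemma exists_paramBound_dilation_mul_log (hT : 0 < T) (hp : Continuous p)
    (hp01 : ∀ x, p x ∈ Icc (0:ℝ) 1) (m : ℕ) :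
    ∃ C, ParamBound T m (fun _ => C) (fun s x => s * p x * log (s * p x)) := by
  have hcont : ContinuousOn (fun t : ℝ => t * log t) (Icc 0 T) :=
    Real.continuous_mul_log.continuousOn
  obtain ⟨C, hC⟩ := isCompact_Icc.exists_bound_of_continuousOn hcont
  have hC0 := (norm_nonneg _).trans (hC T ⟨hT.le, le_rfl⟩)
  induction m with
  | zero =>
    exact ⟨C, .zero (continuousOn_dilation hp hp01 hcont)
      (fun t ht x => hC _ (dilation_mem hp01 ht x)) fun t ht => hC0⟩
  | succ m ih =>
    obtain ⟨D, hD⟩ := ih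
    have hD2 := hD.add (paramBound_dilation_id hp hp01 m)
    refine ⟨max C (D + T), .succ (fun t ht => continuous_dilation hp hp01 hcont ht)
      (fun t ht x => (hC _ (dilation_mem hp01 ht x)).trans (le_max_left _ _))
      (fun t ht => hC0.trans (le_max_left _ _)) (fun t ht x => ?_)
      (hD2.mono fun t ht => le_trans (by linarith [ht.2]) (le_max_right _ _))⟩
    rcases (hp01 x).1.eq_or_lt with h0 | h0
    · simpa [← h0] using hasDerivWithinAt_const t (Ioc 0 T) (0:ℝ)
    · have h1 : 0 < t * p x := mul_pos ht.1 h0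
      convert hasDerivWithinAt_dilation hp01 ht
        (Real.hasDerivAt_mul_log h1.ne').hasDerivWithinAt using 1
      ring

end Dilation

end ParamBound

section Kernel

lemma exists_rpow_variable_le {T : ℝ} {α : ℝ → ℝ}
    (hα : ∀ t ∈ Icc 0 T, 0 ≤ α t ∧ α t ≤ 1) (hT : 0 < T)
    (hlim : ∃ ℓ : ℝ, Tendsto (fun t => (α t - α 0) * Real.log t)
      (nhdsWithin 0 (Ioi 0)) (nhds ℓ)) :
    ∃ C, 0 ≤ C ∧ ∀ t ∈ Ioc 0 T, t ^ (1 - α t) ≤ C * t ^ (1 - α 0) := by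
  obtain ⟨ℓ, hℓ⟩ := hlim
  have h1 : ∀ᶠ t in nhdsWithin 0 (Ioi 0), ℓ - 1 < (α t - α 0) * Real.log t :=
    hℓ.eventually_const_lt (by linarith)
  obtain ⟨δ, hδ, hδ'⟩ := mem_nhdsGT_iff_exists_Ioo_subset.1 h1
  have hδ0 : 0 < δ := hδ
  have hlogc : ContinuousOn Real.log (Icc δ T) :=
    Real.continuousOn_log.mono fun t ht => (hδ0.trans_le ht.1).ne'
  obtain ⟨M, hM⟩ := isCompact_Icc.exists_bound_of_continuousOn hlogc
  have h0 := hα 0 ⟨le_rfl, hT.le⟩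
  refine ⟨Real.exp (max (1 - ℓ) M), (Real.exp_pos _).le, fun t ht => ?_⟩
  have hat := hα t ⟨ht.1.le, ht.2⟩
  have key : -((α t - α 0) * Real.log t) ≤ max (1 - ℓ) M := by
    by_cases htd : t < δ
    · have := hδ' ⟨ht.1, htd⟩
      simp only [mem_ofPred_eq] at this
      exact le_trans (by linarith) (le_max_left _ _)
    · refine le_trans ((neg_le_abs _).trans ?_) (le_max_right _ _)
      rw [abs_mul]
      have h2 : |α t - α 0| ≤ 1 := abs_le.2 ⟨by linarith [hat.1], by linarith [hat.2]⟩
      exact (mul_le_of_le_one_left (abs_nonneg _) h2).trans (hM t ⟨not_lt.1 htd, ht.2⟩)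
  rw [Real.rpow_def_of_pos ht.1, Real.rpow_def_of_pos ht.1, ← Real.exp_add]
  exact Real.exp_le_exp.2 (by linarith)

lemma continuousOn_log_pow_mul_rpow (j : ℕ) {δ : ℝ} (hδ : 0 < δ) :
    ContinuousOn (fun x : ℝ => log x ^ j * x ^ δ) (Ici 0) := by
  rcases Nat.eq_zero_or_pos j with rfl | hj
  · simpa using (Real.continuous_rpow_const hδ.le).continuousOn
  · have hj' : (0:ℝ) < j := by exact_mod_cast hj
    have hcont : Continuous fun x : ℝ => (j / δ * (x ^ (δ / j) * log (x ^ (δ / j)))) ^ j :=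
      (continuous_const.mul (Real.continuous_mul_log.comp
        (Real.continuous_rpow_const (div_pos hδ hj').le))).pow j
    refine hcont.continuousOn.congr fun x hx => ?_
    rcases (mem_Ici.1 hx).eq_or_lt with rfl | hx
    · simp [hj.ne', (div_pos hδ hj').ne', hδ.ne']
    · have h1 : x ^ δ = (x ^ (δ / j)) ^ j := by
        rw [← Real.rpow_natCast, ← Real.rpow_mul hx.le, div_mul_cancel₀ _ hj'.ne']
      simp only
      rw [h1, ← mul_pow, Real.log_rpow hx]
      congr 1
      field_simp

variable {K : Type*} [TopologicalSpace K] [CompactSpace K] {T : ℝ} {p q : K → ℝ}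

lemma exists_paramBound_dilation_rpow (hT : 0 < T) (hp : Continuous p)
    (hp01 : ∀ x, p x ∈ Icc (0:ℝ) 1) {α : ℝ → ℝ}
    (hα : ∀ t ∈ Icc 0 T, 0 ≤ α t ∧ α t < 1)
    (hlim : ∃ ℓ : ℝ, Tendsto (fun t => (α t - α 0) * Real.log t)
      (nhdsWithin 0 (Ioi 0)) (nhds ℓ)) {m : ℕ} (hαm : ContDiffOn ℝ m α (Icc 0 T)) :
    ∃ C, ParamBound T m (fun t => C * t ^ (1 - α 0))
      (fun s x => (s * p x) ^ (1 - α (s * p x))) := by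
  obtain ⟨C, hC0, hC⟩ := exists_rpow_variable_le
    (fun t ht => ⟨(hα t ht).1, (hα t ht).2.le⟩) hT hlim
  have hα0 := (hα 0 ⟨le_rfl, hT.le⟩).2
  have hw : ∀ t ∈ Ioc 0 T, ∀ x : K,
      |(t * p x) ^ (1 - α (t * p x))| ≤ C * t ^ (1 - α 0) := fun t ht x => by
    have hm := dilation_mem hp01 ht x
    rw [abs_of_nonneg (Real.rpow_nonneg hm.1 _)]
    rcases hm.1.eq_or_lt with h0 | h0
    · rw [← h0, Real.zero_rpow (by linarith)]
      exact mul_nonneg hC0 (Real.rpow_nonneg ht.1.le _)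
    · refine (hC _ ⟨h0, hm.2⟩).trans (mul_le_mul_of_nonneg_left ?_ hC0)
      exact Real.rpow_le_rpow hm.1 (mul_le_of_le_one_right ht.1.le (hp01 x).2) (by linarith)
  have hw0 : ∀ t ∈ Ioc 0 T, 0 ≤ C * t ^ (1 - α 0) := fun t ht =>
    mul_nonneg hC0 (Real.rpow_nonneg ht.1.le _)
  have hcont : ContinuousOn (fun t => t ^ (1 - α t)) (Icc 0 T) :=
    continuousOn_id.rpow (continuousOn_const.sub hαm.continuousOn) fun t ht =>
      Or.inr (by linarith [(hα t ht).2])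
  induction m with
  | zero => exact ⟨C, .zero (continuousOn_dilation hp hp01 hcont) hw hw0⟩
  | succ m ih =>
    have hαs := hαm
    push_cast at hαs
    rw [contDiffOn_succ_iff_derivWithin (uniqueDiffOn_Icc hT)] at hαs
    obtain ⟨D, hD⟩ := ih (hαm.of_le (by exact_mod_cast m.le_succ))
    obtain ⟨A, hA⟩ := exists_paramBound_dilation hT hp hp01
      (hαm.of_le (by exact_mod_cast m.le_succ : (m : WithTop ℕ∞) ≤ (m + 1 : ℕ)))
    obtain ⟨B, hB⟩ := exists_paramBound_dilation hT hp hp01 hαs.2.2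
    obtain ⟨H, hH⟩ := exists_paramBound_dilation_mul_log hT hp hp01 m
    have h1 := ParamBound.exists_const (T := T) (m := m) (1 : C(K, ℝ))
    have h2 := hD.mul ((h1.add hA.neg).add (hB.mul hH).neg)
    set M := 2 ^ m * (D * (‖(1 : C(K, ℝ))‖ + A + 2 ^ m * (B * H))) with hM
    refine ⟨max C M, .succ
      (fun t ht => continuous_dilation hp hp01 hcont ht)
      (fun t ht x => (hw t ht x).trans (mul_le_mul_of_nonneg_right (le_max_left _ _)
        (Real.rpow_nonneg ht.1.le _)))
      (fun t ht => mul_nonneg (hC0.trans (le_max_left _ _)) (Real.rpow_nonneg ht.1.le _))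
      (fun t ht x => ?_) (h2.mono fun t ht => ?_)⟩
    · rcases (hp01 x).1.eq_or_lt with h0 | h0
      · have : 1 - α 0 ≠ 0 := by linarith
        simpa [← h0, this] using hasDerivWithinAt_const t (Ioc 0 T) (0:ℝ)
      · have hr : 0 < t * p x := mul_pos ht.1 h0
        have hd := (hasDerivWithinAt_id (t * p x) (Icc 0 T)).rpow
          (((hαs.1 _ (dilation_mem hp01 ht x)).hasDerivWithinAt).const_sub 1) hr
        refine (hasDerivWithinAt_dilation (f := fun t => t ^ (1 - α t)) hp01 ht
          hd).congr_deriv ?_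
        have ht0 := ht.1.ne'
        simp only [id, ContinuousMap.one_apply, Real.rpow_sub_one hr.ne']
        field_simp
        ring
    · calc _ = M * t ^ (1 - α 0) := by rw [hM]; ring
        _ ≤ _ := mul_le_mul_of_nonneg_right (le_max_right _ _) (Real.rpow_nonneg ht.1.le _)

lemma exists_paramBound_log_pow_mul_rpow (hT : 0 < T) (hp : Continuous p)
    (hp01 : ∀ x, p x ∈ Icc (0:ℝ) 1) (hq : Continuous q) (hq01 : ∀ x, q x ∈ Icc (0:ℝ) 1)
    {α : ℝ → ℝ} {αstar β : ℝ} (hβ : αstar < β) (hα : ∀ t ∈ Icc 0 T, α t ≤ αstar)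
    {m : ℕ} (hαm : ContDiffOn ℝ m α (Icc 0 T)) (j : ℕ) :
    ∃ C, ParamBound T m (fun _ => C)
      (fun s x => log (q x) ^ j * q x ^ (β - α (s * p x))) := by
  set δ := (β - αstar) / 2 with hδ
  have hδ0 : 0 < δ := by rw [hδ]; linarith
  have hsplit : ∀ t ∈ Ioc 0 T, ∀ x, ∀ j : ℕ, log (q x) ^ j * q x ^ (β - α (t * p x)) =
      (log (q x) ^ j * q x ^ δ) * q x ^ (β - δ - α (t * p x)) := fun t ht x j => by
    have := hα _ (dilation_mem hp01 ht x)
    rw [mul_assoc, ← Real.rpow_add_of_nonneg (hq01 x).1 hδ0.le (by rw [hδ]; linarith)]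
    congr 2
    ring
  have hbd : ∀ j : ℕ, ∃ C, 0 ≤ C ∧ ∀ t ∈ Ioc 0 T, ∀ x : K,
      |log (q x) ^ j * q x ^ (β - α (t * p x))| ≤ C := fun j => by
    obtain ⟨C, hC⟩ := (isCompact_Icc (a := (0:ℝ)) (b := 1)).exists_bound_of_continuousOn
      ((continuousOn_log_pow_mul_rpow j hδ0).mono Icc_subset_Ici_self)
    refine ⟨C, (norm_nonneg _).trans (hC 0 (by simp)), fun t ht x => ?_⟩
    have := hα _ (dilation_mem hp01 ht x)
    rw [hsplit t ht x, abs_mul, abs_of_nonneg (Real.rpow_nonneg (hq01 x).1 (β - δ - _))]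
    exact (mul_le_of_le_one_right (abs_nonneg _) (Real.rpow_le_one (hq01 x).1 (hq01 x).2
      (by rw [hδ]; linarith))).trans (hC _ (hq01 x))
  have hcont : ∀ j : ℕ, ContinuousOn (Function.uncurry fun (s : ℝ) (x : K) =>
      log (q x) ^ j * q x ^ (β - α (s * p x))) (Ioc 0 T ×ˢ univ) := fun j => by
    have h1 : Continuous fun x => log (q x) ^ j * q x ^ δ :=
      (continuousOn_log_pow_mul_rpow j hδ0).comp_continuous hq fun x => (hq01 x).1
    have h2 : ContinuousOn (fun y : ℝ × K => q y.2 ^ (β - δ - α (y.1 * p y.2)))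
        (Ioc 0 T ×ˢ univ) := by
      refine ContinuousOn.rpow (by fun_prop) (continuousOn_const.sub
        (continuousOn_dilation hp hp01 hαm.continuousOn)) fun y hy => Or.inr ?_
      have := hα _ (dilation_mem hp01 hy.1 y.2)
      rw [hδ]; linarith
    exact ((h1.comp continuous_snd).continuousOn.mul h2).congr
      fun y hy => hsplit y.1 hy.1 y.2 j
  induction m generalizing j with
  | zero =>
    obtain ⟨C, hC0, hC⟩ := hbd j
    exact ⟨C, .zero (hcont j) hC fun _ _ => hC0⟩
  | succ m ih =>
    obtain ⟨C, hC0, hC⟩ := hbd j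
    have hαs := hαm
    push_cast at hαs
    rw [contDiffOn_succ_iff_derivWithin (uniqueDiffOn_Icc hT)] at hαs
    obtain ⟨D, hD⟩ := ih (hαm.of_le (by exact_mod_cast m.le_succ)) (j + 1)
    obtain ⟨B, hB⟩ := exists_paramBound_dilation hT hp hp01 hαs.2.2
    have h2 := (((paramBound_dilation_id hp hp01 m).mono fun t ht => ht.2).mul hB).mul hD
    refine ⟨max C _, .succ (fun t ht => ?_) (fun t ht x => (hC t ht x).trans (le_max_left _ _))
      (fun _ _ => hC0.trans (le_max_left _ _)) (fun t ht x => ?_)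
      (h2.neg.mono fun t ht => le_max_right _ _)⟩
    · exact (hcont j).comp_continuous (f := fun x => (t, x)) (by fun_prop) fun x => ⟨ht, trivial⟩
    · rcases (hq01 x).1.eq_or_lt with h0 | h0
      · have h3 : ∀ s ∈ Ioc 0 T, β - α (s * p x) ≠ 0 := fun s hs => by
          have := hα _ (dilation_mem hp01 hs x)
          linarith
        refine ((hasDerivWithinAt_const t (Ioc 0 T) (0:ℝ)).congr (fun s hs => ?_) ?_).congr_deriv
          ?_
        · simp [← h0, h3 s hs]
        · simp [← h0, h3 t ht]
        · simp [← h0]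
      · have hd := ((((hαs.1 _ (dilation_mem hp01 ht x)).hasDerivWithinAt).const_sub β).const_rpow
          h0).const_mul (log (q x) ^ j)
        refine (hasDerivWithinAt_dilation (f := fun t => log (q x) ^ j * q x ^ (β - α t)) hp01 ht
          hd).congr_deriv ?_
        ring

/-- The kernel of the rescaled variable-order integral operator, conjugated by `exp (σ θ)`, with
the factor `r ^ (-β)` split off; here `r` stands for `1 - η`. -/
noncomputable def rescaledKernel (a α : ℝ → ℝ) (β σ s θ r : ℝ) : ℝ :=
  exp (-(σ * θ * r)) * (a (s * θ) * ((s * θ) ^ (1 - α (s * θ)) * r ^ (β - α (s * θ))))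

lemma exists_paramBound_rescaledKernel (hT : 0 < T) (hp : Continuous p)
    (hp01 : ∀ x, p x ∈ Icc (0:ℝ) 1) (hq : Continuous q) (hq01 : ∀ x, q x ∈ Icc (0:ℝ) 1)
    {a α : ℝ → ℝ} {αstar β : ℝ} (hβ : αstar < β) (hαstar : αstar < 1)
    (hα : ∀ t ∈ Icc 0 T, 0 ≤ α t ∧ α t ≤ αstar)
    (hlim : ∃ ℓ : ℝ, Tendsto (fun t => (α t - α 0) * Real.log t)
      (nhdsWithin 0 (Ioi 0)) (nhds ℓ))
    {m : ℕ} (ham : ContDiffOn ℝ m a (Icc 0 T)) (hαm : ContDiffOn ℝ m α (Icc 0 T)) (σ : ℝ) :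
    ∃ C, ParamBound T m (fun t => C * t ^ (1 - α 0))
      (fun s x => rescaledKernel a α β σ s (p x) (q x)) := by
  obtain ⟨A, hA⟩ := exists_paramBound_dilation hT hp hp01 ham
  obtain ⟨B, hB⟩ := exists_paramBound_dilation_rpow hT hp hp01
    (fun t ht => ⟨(hα t ht).1, (hα t ht).2.trans_lt hαstar⟩) hlim hαm
  obtain ⟨D, hD⟩ := exists_paramBound_log_pow_mul_rpow hT hp hp01 hq hq01 hβ
    (fun t ht => (hα t ht).2) hαm 0
  have hE := ParamBound.exists_const (T := T) (m := m)
    (⟨fun x => exp (-(σ * p x * q x)), by fun_prop⟩ : C(K, ℝ))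
  set E := ‖(⟨fun x => exp (-(σ * p x * q x)), by fun_prop⟩ : C(K, ℝ))‖
  refine ⟨2 ^ m * (E * (2 ^ m * (A * (2 ^ m * (B * D))))),
    ((hE.mul (hA.mul (hB.mul hD))).congr fun t _ x => ?_).mono fun t _ => le_of_eq (by ring)⟩
  simp [rescaledKernel]

lemma exp_neg_le_rpow_neg {z q : ℝ} (hz : 0 < z) (hq0 : 0 ≤ q) (hq1 : q ≤ 1) :
    exp (-z) ≤ z ^ (-q) := by
  rw [Real.exp_neg, Real.rpow_neg hz.le]
  refine inv_anti₀ (Real.rpow_pos_of_pos hz q) ?_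
  rcases le_total z 1 with h | h
  · exact (Real.rpow_le_one hz.le h hq0).trans (Real.one_le_exp hz.le)
  · calc z ^ q ≤ z ^ (1:ℝ) := Real.rpow_le_rpow_of_exponent_le h hq1
      _ = z := Real.rpow_one z
      _ ≤ exp z := by linarith [Real.add_one_le_exp z]

lemma exists_rescaledKernel_le (hT : 0 < T) {a α : ℝ → ℝ} {αstar β ρ : ℝ} (hρ : 0 < ρ)
    (hβ : αstar + ρ = β) (hβ1 : β ≤ 1) (hα : ∀ t ∈ Icc 0 T, 0 ≤ α t ∧ α t ≤ αstar)
    (ha : ContinuousOn a (Icc 0 T)) :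
    ∃ C, 0 ≤ C ∧ ∀ σ > 0, ∀ s ∈ Ioc 0 T, ∀ θ ∈ Icc (0:ℝ) 1, ∀ r ∈ Icc (0:ℝ) 1,
      |rescaledKernel a α β σ s θ r| ≤ C * σ ^ (-ρ) := by
  obtain ⟨A, hA⟩ := isCompact_Icc.exists_bound_of_continuousOn ha
  have hA0 : 0 ≤ A := (norm_nonneg _).trans (hA T ⟨hT.le, le_rfl⟩)
  have hT1 : 0 ≤ max 1 T := by positivity
  refine ⟨A * max 1 T, by positivity, fun σ hσ s hs θ hθ r hr => ?_⟩
  have hm : s * θ ∈ Icc 0 T := ⟨mul_nonneg hs.1.le hθ.1,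
    (mul_le_of_le_one_right hs.1.le hθ.2).trans hs.2⟩
  have hαt := hα _ hm
  have hrhs : 0 ≤ A * max 1 T * σ ^ (-ρ) := by positivity
  unfold rescaledKernel
  rcases hθ.1.eq_or_lt with h0 | h0
  · rw [← h0, mul_zero] at hαt
    have hz : (0:ℝ) ^ (1 - α 0) = 0 := Real.zero_rpow (by linarith [hαt.2])
    simpa [← h0, hz] using hrhs
  rcases hr.1.eq_or_lt with h1 | h1
  · rw [← h1, Real.zero_rpow (by linarith)]
    simpa using hrhs
  set b := α (s * θ)
  have hs1 : s ^ (1 - b) ≤ max 1 T := by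
    rcases le_total s 1 with h | h
    · exact (Real.rpow_le_one hs.1.le h (by linarith)).trans (le_max_left _ _)
    · calc s ^ (1 - b) ≤ s ^ (1:ℝ) := Real.rpow_le_rpow_of_exponent_le h (by linarith)
        _ = s := Real.rpow_one s
        _ ≤ _ := hs.2.trans (le_max_right _ _)
  have he : exp (-(σ * θ * r)) ≤ σ ^ (-ρ) * θ ^ (-ρ) * r ^ (-ρ) := by
    refine (exp_neg_le_rpow_neg (by positivity) hρ.le (by linarith)).trans (le_of_eq ?_)
    rw [Real.mul_rpow (by positivity) h1.le, Real.mul_rpow hσ.le h0.le]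
  have h2 : θ ^ (-ρ) * θ ^ (1 - b) ≤ 1 := by
    rw [← Real.rpow_add h0]
    exact Real.rpow_le_one h0.le hθ.2 (by linarith)
  have h3 : r ^ (-ρ) * r ^ (β - b) ≤ 1 := by
    rw [← Real.rpow_add h1]
    exact Real.rpow_le_one h1.le hr.2 (by linarith)
  rw [abs_mul, abs_mul, abs_mul, Real.mul_rpow hs.1.le h0.le, abs_of_pos (exp_pos _),
    abs_of_nonneg (Real.rpow_nonneg hr.1 _),
    abs_of_nonneg (mul_nonneg (Real.rpow_nonneg hs.1.le _) (Real.rpow_nonneg h0.le _))]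
  have hs0 := Real.rpow_nonneg hs.1.le (1 - b)
  have ht0 := Real.rpow_nonneg h0.le (1 - b)
  have hr0 := Real.rpow_nonneg h1.le (β - b)
  have hσ0 := Real.rpow_nonneg hσ.le (-ρ)
  calc exp (-(σ * θ * r)) * (|a (s * θ)| * (s ^ (1 - b) * θ ^ (1 - b) * r ^ (β - b)))
      ≤ (σ ^ (-ρ) * θ ^ (-ρ) * r ^ (-ρ)) *
        (A * (max 1 T * θ ^ (1 - b) * r ^ (β - b))) := by
        gcongr
        exact hA _ hm
    _ = A * max 1 T * σ ^ (-ρ) * ((θ ^ (-ρ) * θ ^ (1 - b)) * (r ^ (-ρ) * r ^ (β - b))) := by ring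
    _ ≤ A * max 1 T * σ ^ (-ρ) * (1 * 1) := by
        gcongr
    _ = _ := by ring

end Kernel

section Operator

open MeasureTheory unitInterval

lemma integrable_one_sub_rpow_neg {β : ℝ} (hβ : β < 1) :
    Integrable (fun η : I => (1 - (η : ℝ)) ^ (-β)) := by
  have h1 : IntervalIntegrable (fun x : ℝ => (1 - x) ^ (-β)) volume 0 1 := by
    have := (intervalIntegral.intervalIntegrable_rpow' (a := 0) (b := 1)
      (by linarith : -1 < -β)).comp_sub_left 1
    simpa using this.symm
  rw [intervalIntegrable_iff_integrableOn_Icc_of_le zero_le_one] at h1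
  exact (integrableOn_iff_comap_subtypeVal measurableSet_Icc).1 h1

lemma integrable_weighted {β : ℝ} (hβ : β < 1) {g : I → ℝ} (hg : Continuous g) :
    Integrable (fun η : I => g η * (1 - (η : ℝ)) ^ (-β)) := by
  obtain ⟨C, hC⟩ := (isCompact_univ (X := I)).exists_bound_of_continuousOn hg.continuousOn
  exact (integrable_one_sub_rpow_neg hβ).bdd_mul hg.aestronglyMeasurable
    (Eventually.of_forall fun x => hC x trivial)

/-- The map taking a kernel `κ` and `w` to `θ ↦ ∫ κ(θ, η) w(θ η) (1 - η) ^ (-β) dη`. -/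
noncomputable def dilationIntegral {β : ℝ} (hβ : β < 1) (κ : C(I × I, ℝ)) (w : C(I, ℝ)) :
    C(I, ℝ) where
  toFun θ := ∫ η : I, κ (θ, η) * w (θ * η) * (1 - (η : ℝ)) ^ (-β)
  continuous_toFun := by
    refine continuous_of_dominated (bound := fun η : I => ‖κ‖ * ‖w‖ * (1 - (η : ℝ)) ^ (-β))
      (fun θ => (integrable_weighted hβ (by fun_prop)).aestronglyMeasurable)
      (fun θ => Eventually.of_forall fun η => ?_)
      ((integrable_one_sub_rpow_neg hβ).const_mul _)
      (Eventually.of_forall fun η => by fun_prop)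
    have h0 : 0 ≤ (1 - (η : ℝ)) ^ (-β) := Real.rpow_nonneg (by linarith [η.2.2]) _
    rw [norm_mul, norm_mul, Real.norm_of_nonneg h0]
    gcongr
    · exact κ.norm_coe_le_norm _
    · exact w.norm_coe_le_norm _

lemma norm_dilationIntegral_le {β : ℝ} (hβ : β < 1) (κ : C(I × I, ℝ)) (w : C(I, ℝ)) :
    ‖dilationIntegral hβ κ w‖ ≤ (∫ η : I, (1 - (η : ℝ)) ^ (-β)) * ‖κ‖ * ‖w‖ := by
  have hpos : ∀ η : I, 0 ≤ (1 - (η : ℝ)) ^ (-β) := fun η =>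
    Real.rpow_nonneg (by linarith [η.2.2]) _
  have hI : 0 ≤ ∫ η : I, (1 - (η : ℝ)) ^ (-β) := integral_nonneg hpos
  refine (ContinuousMap.norm_le _ (by positivity)).2 fun θ => ?_
  calc ‖∫ η : I, κ (θ, η) * w (θ * η) * (1 - (η : ℝ)) ^ (-β)‖
      ≤ ∫ η : I, ‖κ‖ * ‖w‖ * (1 - (η : ℝ)) ^ (-β) := by
        refine norm_integral_le_of_norm_le ((integrable_one_sub_rpow_neg hβ).const_mul _)
          (Eventually.of_forall fun η => ?_)
        rw [norm_mul, norm_mul, Real.norm_of_nonneg (hpos η)]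
        have := hpos η
        gcongr
        · exact κ.norm_coe_le_norm _
        · exact w.norm_coe_le_norm _
    _ = _ := by rw [integral_const_mul]; ring

/-- `dilationIntegral` as a bounded bilinear map. -/
noncomputable def dilationIntegralCLM {β : ℝ} (hβ : β < 1) :=
  LinearMap.mkContinuous₂
    (LinearMap.mk₂ ℝ (dilationIntegral hβ)
      (fun κ₁ κ₂ w => by
        ext θ
        simp only [dilationIntegral, ContinuousMap.coe_mk, ContinuousMap.add_apply]
        rw [← integral_add (integrable_weighted hβ (g := fun η => κ₁ (θ, η) * w (θ * η))
          (by fun_prop)) (integrable_weighted hβ (g := fun η => κ₂ (θ, η) * w (θ * η))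
          (by fun_prop))]
        exact integral_congr_ae (Eventually.of_forall fun η => by simp only; ring))
      (fun c κ w => by
        ext θ
        simp only [dilationIntegral, ContinuousMap.coe_mk, ContinuousMap.smul_apply, smul_eq_mul]
        rw [← integral_const_mul]
        exact integral_congr_ae (Eventually.of_forall fun η => by simp only; ring))
      (fun κ w₁ w₂ => by
        ext θ
        simp only [dilationIntegral, ContinuousMap.coe_mk, ContinuousMap.add_apply]
        rw [← integral_add (integrable_weighted hβ (g := fun η => κ (θ, η) * w₁ (θ * η))
          (by fun_prop)) (integrable_weighted hβ (g := fun η => κ (θ, η) * w₂ (θ * η))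
          (by fun_prop))]
        exact integral_congr_ae (Eventually.of_forall fun η => by simp only; ring))
      (fun c κ w => by
        ext θ
        simp only [dilationIntegral, ContinuousMap.coe_mk, ContinuousMap.smul_apply, smul_eq_mul]
        rw [← integral_const_mul]
        exact integral_congr_ae (Eventually.of_forall fun η => by simp only; ring)))
    (∫ η : I, (1 - (η : ℝ)) ^ (-β)) (norm_dilationIntegral_le hβ)

lemma dilationIntegralCLM_apply {β : ℝ} (hβ : β < 1) (κ : C(I × I, ℝ)) (w : C(I, ℝ)) (θ : I) :
    dilationIntegralCLM hβ κ w θ = ∫ η : I, κ (θ, η) * w (θ * η) * (1 - (η : ℝ)) ^ (-β) := rfl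

lemma integral_mul_sub_rpow_eq {t : ℝ} (ht : 0 < t) (v : ℝ → ℝ) (b : ℝ) :
    ∫ r in (0:ℝ)..t, v r * (t - r) ^ (-b) =
      t ^ (1 - b) * ∫ η : I, v (t * η) * (1 - (η : ℝ)) ^ (-b) := by
  have h1 := intervalIntegral.smul_integral_comp_mul_left (a := 0) (b := 1)
    (fun r => v r * (t - r) ^ (-b)) t
  rw [mul_zero, mul_one] at h1
  have h2 : ∫ η : I, v (t * η) * (1 - (η : ℝ)) ^ (-b) =
      ∫ η in (0:ℝ)..1, v (t * η) * (1 - η) ^ (-b) := by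
    rw [intervalIntegral.integral_of_le zero_le_one, ← integral_Icc_eq_integral_Ioc]
    exact integral_subtype_comap measurableSet_Icc fun η : ℝ => v (t * η) * (1 - η) ^ (-b)
  rw [← h1, h2, ← intervalIntegral.integral_const_mul, smul_eq_mul,
    ← intervalIntegral.integral_const_mul]
  refine intervalIntegral.integral_congr fun η hη => ?_
  rw [uIcc_of_le zero_le_one] at hη
  rw [show t - t * η = t * (1 - η) by ring, Real.mul_rpow ht.le (by linarith [hη.2]),
    sub_eq_add_neg 1 b, Real.rpow_add ht, Real.rpow_one]
  ring

lemma dilationIntegralCLM_rescaledKernel {a α v : ℝ → ℝ} {β τ s : ℝ} (hβ : β < 1)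
    (hs : 0 < s) {κ : C(I × I, ℝ)} {w : C(I, ℝ)}
    (hκ : ∀ x : I × I, κ x = rescaledKernel a α β τ s x.1 (1 - x.2))
    (hw : ∀ θ : I, w θ = exp (-(τ * θ)) * v (s * θ)) {θ : I} (hθ : 0 < θ) :
    dilationIntegralCLM hβ κ w θ = exp (-(τ * θ)) * (a (s * θ) *
      ∫ r in (0:ℝ)..(s * θ), v r * (s * θ - r) ^ (-(α (s * θ)))) := by
  have hθ' : (0:ℝ) < θ := hθ
  rw [dilationIntegralCLM_apply, integral_mul_sub_rpow_eq (mul_pos hs hθ'), ← mul_assoc (a _),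
    ← mul_assoc, ← integral_const_mul]
  have hae : ∀ᵐ η : I, η ≠ 1 := by
    simp [ae_iff]
  refine integral_congr_ae (hae.mono fun η hη => ?_)
  have h1 : (0:ℝ) < 1 - η := by
    have : (η : ℝ) < 1 := lt_of_le_of_ne η.2.2 fun h => hη (Subtype.ext h)
    linarith
  simp only [hκ, hw, rescaledKernel, Set.Icc.coe_mul]
  rw [Real.rpow_sub h1, Real.rpow_neg h1.le, Real.rpow_neg h1.le,
    show -(τ * (θ : ℝ)) = -(τ * θ * (1 - η)) + -(τ * (θ * η)) by ring, Real.exp_add,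
    ← mul_assoc s]
  have := (Real.rpow_pos_of_pos h1 β).ne'
  field_simp

lemma exists_rescaled_operator {T : ℝ} (hT : 0 < T) {a α : ℝ → ℝ} {αstar : ℝ}
    (hαstar : αstar < 1) (hα : ∀ t ∈ Icc 0 T, 0 ≤ α t ∧ α t ≤ αstar)
    (hlim : ∃ ℓ : ℝ, Tendsto (fun t => (α t - α 0) * Real.log t)
      (nhdsWithin 0 (Ioi 0)) (nhds ℓ))
    {m : ℕ} (ham : ContDiffOn ℝ m a (Icc 0 T)) (hαm : ContDiffOn ℝ m α (Icc 0 T)) :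
    ∃ τ > 0, ∃ C, 0 ≤ C ∧ ∃ S : ℝ → C(I, ℝ) →L[ℝ] C(I, ℝ),
      EulerBound T m (fun t => C * t ^ (1 - α 0)) S ∧ (∀ t ∈ Ioc 0 T, ‖S t‖ ≤ 1 / 4) ∧
      ∀ (v : ℝ → ℝ) (w : C(I, ℝ)), ∀ s ∈ Ioc 0 T,
        (∀ θ : I, w θ = exp (-(τ * θ)) * v (s * θ)) → ∀ θ : I, 0 < θ →
          S s w θ = exp (-(τ * θ)) * (a (s * θ) *
            ∫ r in (0:ℝ)..(s * θ), v r * (s * θ - r) ^ (-(α (s * θ)))) := by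
  set ρ := (1 - αstar) / 2 with hρ
  have hρ0 : 0 < ρ := by rw [hρ]; linarith
  set β := αstar + ρ with hβdef
  have hβ1 : β < 1 := by rw [hβdef, hρ]; linarith
  obtain ⟨C₁, hC₁, hle⟩ := exists_rescaledKernel_le hT hρ0 hβdef.symm hβ1.le hα ham.continuousOn
  have hev : ∀ᶠ τ : ℝ in atTop, ‖dilationIntegralCLM hβ1‖ * (C₁ * τ ^ (-ρ)) < 1 / 4 := by
    have : Tendsto (fun τ : ℝ => ‖dilationIntegralCLM hβ1‖ * (C₁ * τ ^ (-ρ))) atTop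
        (nhds (‖dilationIntegralCLM hβ1‖ * (C₁ * 0))) :=
      ((tendsto_rpow_neg_atTop hρ0).const_mul _).const_mul _
    exact this.eventually_lt_const (by norm_num)
  obtain ⟨τ, hτ, hτ0⟩ := (hev.and (eventually_gt_atTop 0)).exists
  obtain ⟨C, F, hF, hF'⟩ := exists_paramBound_rescaledKernel (K := I × I) (p := fun x => x.1)
    (q := fun x => 1 - x.2) hT (by fun_prop) (fun x => x.1.2) (by fun_prop)
    (fun x => ⟨by linarith [x.2.2.2], by linarith [x.2.2.1]⟩)
    (show αstar < β by linarith) hαstar hα hlim ham hαm τ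
  have hS := hF.clm_comp (F := C(I, ℝ) →L[ℝ] C(I, ℝ)) (dilationIntegralCLM hβ1)
  refine ⟨τ, hτ0, ‖dilationIntegralCLM hβ1‖ * |C|, by positivity,
    fun t => dilationIntegralCLM hβ1 (F t), hS.mono fun t ht => ?_, fun t ht => ?_,
    fun v w s hs hw θ hθ => dilationIntegralCLM_rescaledKernel hβ1 hs.1 (hF' s hs) hw hθ⟩
  · have := Real.rpow_nonneg ht.1.le (1 - α 0)
    rw [mul_assoc]
    gcongr
    exact le_abs_self C
  · refine ((dilationIntegralCLM hβ1).le_opNorm_of_le ?_).trans hτ.le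
    refine (ContinuousMap.norm_le _ (by positivity)).2 fun x => ?_
    rw [hF' t ht]
    exact hle τ hτ0 t ht x.1 x.1.2 _ ⟨by linarith [x.2.2.2], by linarith [x.2.2.1]⟩

end Operator

section Mode

open MeasureTheory unitInterval

lemma EulerBound.const_smul {X : Type*} [NormedAddCommGroup X] [NormedSpace ℝ X] {T : ℝ} {m : ℕ}
    {w : ℝ → ℝ} {f : ℝ → X} (h : EulerBound T m w f) (c : ℝ) :
    EulerBound T m (fun t => |c| * w t) (fun t => c • f t) := by
  refine (h.clm_comp (c • ContinuousLinearMap.id ℝ X)).mono fun t ht => ?_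
  have h0 : 0 ≤ w t := (norm_nonneg _).trans (h.norm_le ht)
  gcongr
  rw [norm_smul, Real.norm_eq_abs]
  exact mul_le_of_le_one_right (abs_nonneg c) ContinuousLinearMap.norm_id_le

lemma EulerBound.exists_resolvent {X : Type*} [NormedAddCommGroup X] [NormedSpace ℝ X]
    [CompleteSpace X] {T : ℝ} {m : ℕ} {S : ℝ → X →L[ℝ] X} {C : ℝ}
    (hS : EulerBound T m (fun _ => C) S) (hsmall : ∀ t ∈ Ioc 0 T, ‖S t‖ ≤ 1 / 2) :
    ∃ D, 0 ≤ D ∧ ∀ j ≤ m, ∀ (w : ℝ → ℝ) (V F : ℝ → X), EulerBound T j w F →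
      (∀ t ∈ Ioc 0 T, V t + S t (V t) = F t) → EulerBound T j (fun t => D * w t) V := by
  obtain ⟨D, hD⟩ := hS.ringInverse hsmall
  refine ⟨2 ^ m * |D|, by positivity, fun j hj w V F hF hV => ?_⟩
  refine (((hD.of_le hj).clm_apply hF).congr fun t ht => ?_).mono fun t ht => ?_
  · have hunit : IsUnit (1 + S t) := by
      have := isUnit_one_sub_of_norm_lt_one (x := -S t)
        (by rw [norm_neg]; linarith [hsmall t ht])
      simpa using this
    have h1 : F t = (1 + S t) (V t) := by simp [hV t ht]
    rw [h1, ← mul_apply_eq_comp, Ring.inverse_mul_cancel _ hunit]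
    rfl
  · have h0 : 0 ≤ w t := (norm_nonneg _).trans (hF.norm_le ht)
    have hD0 : 0 ≤ D := (norm_nonneg _).trans (hD.norm_le ht)
    rw [← mul_assoc]
    gcongr
    · norm_num
    · exact le_abs_self D

/-- `u` has derivative `v` on `[0, T]` and `v + a ∫₀ᵗ v(r) (t - r) ^ (-α(t)) dr = -lam u`
on `(0, T]`. -/
structure IsFractionalMode (T : ℝ) (a α : ℝ → ℝ) (lam : ℝ) (u v : ℝ → ℝ) : Prop where
  hasDeriv : ∀ t ∈ Icc 0 T, HasDerivWithinAt u (v t) (Icc 0 T) t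
  continuousOn_deriv : ContinuousOn v (Icc 0 T)
  equation : ∀ t ∈ Ioc 0 T,
    v t + a t * ∫ r in (0:ℝ)..t, v r * (t - r) ^ (-(α t)) = -lam * u t

lemma IsFractionalMode.continuousOn {T lam : ℝ} {a α u v : ℝ → ℝ}
    (h : IsFractionalMode T a α lam u v) : ContinuousOn u (Icc 0 T) :=
  fun t ht => (h.hasDeriv t ht).continuousWithinAt

lemma IsFractionalMode.rescaled_equation {T lam : ℝ} {a α u v : ℝ → ℝ}
    (h : IsFractionalMode T a α lam u v) {τ s : ℝ} (hs : s ∈ Ioc 0 T) {W Y Z : C(I, ℝ)}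
    (hW : ∀ θ : I, W θ = exp (-(τ * θ)) * v (s * θ))
    (hY : ∀ θ : I, Y θ = exp (-(τ * θ)) * u (s * θ))
    (hZ : ∀ θ : I, 0 < θ → Z θ = exp (-(τ * θ)) * (a (s * θ) *
      ∫ r in (0:ℝ)..(s * θ), v r * (s * θ - r) ^ (-(α (s * θ))))) :
    W + Z = (-lam) • Y := by
  have hd : Dense (Ioi (0 : I)) := by
    rw [dense_iff_closure_eq, closure_Ioi' ⟨1, zero_lt_one⟩]
    exact Set.eq_univ_of_forall fun x => x.2.1
  refine DFunLike.coe_injective (Continuous.ext_on hd (W + Z).continuous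
    ((-lam) • Y).continuous fun θ hθ => ?_)
  have hθ' : (0:ℝ) < θ := hθ
  have := h.equation (s * θ) ⟨mul_pos hs.1 hθ',
    (mul_le_of_le_one_right hs.1.le θ.2.2).trans hs.2⟩
  simp only [ContinuousMap.add_apply, ContinuousMap.smul_apply, smul_eq_mul, hW, hY, hZ θ hθ]
  rw [← mul_add, this]
  ring

lemma IsFractionalMode.bound {T lam : ℝ} {a α u v : ℝ → ℝ} (hT : 0 < T) (hlam : 0 < lam)
    (h : IsFractionalMode T a α lam u v) {τ : ℝ} (hτ : 0 < τ) {A : C(I, ℝ) →L[ℝ] C(I, ℝ)}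
    (hA : ‖A‖ ≤ 1 / 4)
    (hrep : ∀ w : C(I, ℝ), (∀ θ : I, w θ = exp (-(τ * θ)) * v (T * θ)) → ∀ θ : I, 0 < θ →
      A w θ = exp (-(τ * θ)) * (a (T * θ) *
        ∫ r in (0:ℝ)..(T * θ), v r * (T * θ - r) ^ (-(α (T * θ))))) :
    ∀ t ∈ Icc 0 T, |u t| ≤ 2 * exp τ * |u 0| ∧ |v t| ≤ 2 * exp τ * (lam * |u 0|) := by
  have hmem : ∀ θ : I, T * θ ∈ Icc 0 T := fun θ =>
    ⟨mul_nonneg hT.le θ.2.1, mul_le_of_le_one_right hT.le θ.2.2⟩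
  have hmap : MapsTo (fun θ : I => T * (θ : ℝ)) univ (Icc 0 T) := fun θ _ => hmem θ
  have hcomp : ∀ f : ℝ → ℝ, ContinuousOn f (Icc 0 T) →
      Continuous (fun θ : I => exp (-(τ * θ)) * f (T * θ)) := fun f hf =>
    (by fun_prop : Continuous fun θ : I => exp (-(τ * θ))).mul
      (hf.comp_continuous (by fun_prop) hmem)
  set W : C(I, ℝ) := ⟨_, hcomp v h.continuousOn_deriv⟩
  set Y : C(I, ℝ) := ⟨_, hcomp u h.continuousOn⟩
  have hWY : W + A W = (-lam) • Y :=
    h.rescaled_equation ⟨hT, le_rfl⟩ (fun _ => rfl) (fun _ => rfl) (hrep W fun _ => rfl)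
  set N := ‖W‖
  have hN0 : 0 ≤ N := norm_nonneg _
  have hAW : ∀ θ : I, |A W θ| ≤ N / 4 := fun θ => by
    have h1 := (A W).norm_coe_le_norm θ
    have h2 := A.le_of_opNorm_le hA W
    rw [Real.norm_eq_abs] at h1
    linarith
  have hpt : ∀ θ : I, exp (-(τ * θ)) * v (T * θ) + A W θ =
      -lam * (exp (-(τ * θ)) * u (T * θ)) := fun θ => by
    simpa [W, Y] using DFunLike.congr_fun hWY θ
  set μ := lam + τ / T with hμ
  have hμ0 : 0 < μ := by positivity
  have key : ∀ t ∈ Icc 0 T, |exp (lam * t) * u t| ≤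
      |u 0| + N / 4 * ((exp (μ * t) - 1) / μ) := by
    refine image_norm_le_of_norm_deriv_right_le_deriv_boundary'
      (f := fun t => exp (lam * t) * u t)
      (f' := fun t => exp (lam * t) * lam * u t + exp (lam * t) * v t)
      (B' := fun t => N / 4 * exp (μ * t)) ?_ ?_ (by simp) (by fun_prop) ?_ ?_
    · exact (by fun_prop : Continuous fun t => exp (lam * t)).continuousOn.mul h.continuousOn
    · intro t ht
      have h1 : HasDerivAt (fun t => exp (lam * t)) (exp (lam * t) * lam) t := by
        simpa using ((hasDerivAt_id t).const_mul lam).exp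
      have h2 : HasDerivWithinAt u (v t) (Ici t) t :=
        (h.hasDeriv t ⟨ht.1, ht.2.le⟩).mono_of_mem_nhdsWithin
          (mem_of_superset (Icc_mem_nhdsGE ht.2) (Icc_subset_Icc_left ht.1))
      exact h1.hasDerivWithinAt.mul h2
    · intro t ht
      have h1 : HasDerivAt (fun t => exp (μ * t)) (exp (μ * t) * μ) t := by
        simpa using ((hasDerivAt_id t).const_mul μ).exp
      have h2 := (((h1.sub_const 1).div_const μ).const_mul (N / 4)).const_add |u 0|
      rw [mul_div_cancel_right₀ _ hμ0.ne'] at h2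
      exact h2.hasDerivWithinAt
    · intro t ht
      have hθ : t / T ∈ I := ⟨div_nonneg ht.1 hT.le, (div_le_one hT).2 ht.2.le⟩
      have h1 := hpt ⟨t / T, hθ⟩
      simp only [mul_div_cancel₀ t hT.ne'] at h1
      have h2 : exp (lam * t) * lam * u t + exp (lam * t) * v t =
          -(exp (μ * t) * A W ⟨t / T, hθ⟩) := by
        have h3 : exp (μ * t) = exp (lam * t) * exp (τ * (t / T)) := by
          rw [← Real.exp_add, hμ]; ring_nf
        have h4 : exp (τ * (t / T)) * exp (-(τ * (t / T))) = 1 := by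
          rw [← Real.exp_add]; simp
        rw [h3]
        linear_combination (exp (lam * t) * exp (τ * (t / T))) * h1 -
          (exp (lam * t) * (v t + lam * u t)) * h4
      rw [h2, norm_neg, norm_mul, Real.norm_of_nonneg (Real.exp_nonneg _), mul_comm, Real.norm_eq_abs]
      gcongr
      exact hAW _
  have hY : ∀ θ : I, lam * |exp (-(τ * θ)) * u (T * θ)| ≤ lam * |u 0| + N / 4 := fun θ => by
    have h1 := key _ (hmem θ)
    have h2 : exp (-(τ * θ)) * u (T * θ) =
        exp (-(μ * (T * θ))) * (exp (lam * (T * θ)) * u (T * θ)) := by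
      rw [← mul_assoc, ← Real.exp_add, hμ]
      congr 2
      field_simp
      ring
    have h3 : exp (-(μ * (T * θ))) * exp (μ * (T * θ)) = 1 := by
      rw [← Real.exp_add]; simp
    have h4 : exp (-(μ * (T * θ))) ≤ 1 := by
      rw [Real.exp_le_one_iff]
      have := (hmem θ).1
      nlinarith
    have h5 : 0 < exp (-(μ * (T * θ))) := Real.exp_pos _
    rw [h2, abs_mul, abs_of_pos h5]
    have h6 : exp (-(μ * (T * θ))) * |exp (lam * (T * θ)) * u (T * θ)| ≤
        |u 0| + N / 4 * (1 / μ) := by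
      calc _ ≤ exp (-(μ * (T * θ))) * (|u 0| + N / 4 * ((exp (μ * (T * θ)) - 1) / μ)) := by
            gcongr
        _ = exp (-(μ * (T * θ))) * |u 0| + N / 4 * ((1 - exp (-(μ * (T * θ)))) / μ) := by
            linear_combination (N / 4 / μ) * h3
        _ ≤ 1 * |u 0| + N / 4 * (1 / μ) := by
            gcongr
            linarith
        _ = _ := by ring
    have h7 : lam * (1 / μ) ≤ 1 := by
      rw [mul_one_div, div_le_one hμ0, hμ]
      have : 0 < τ / T := by positivity
      linarith
    nlinarith
  have hN : N ≤ 2 * (lam * |u 0|) := by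
    have : N ≤ lam * |u 0| + N / 4 + N / 4 := by
      refine (ContinuousMap.norm_le _ (by positivity)).2 fun θ => ?_
      have h1 : W θ = -lam * (exp (-(τ * θ)) * u (T * θ)) - A W θ := by
        rw [← hpt θ]
        exact (add_sub_cancel_right _ _).symm
      rw [h1]
      refine (norm_sub_le _ _).trans (add_le_add ?_ (hAW θ))
      rw [norm_mul, norm_neg, Real.norm_of_nonneg hlam.le]
      exact hY θ
    linarith
  intro t ht
  have hθ : t / T ∈ I := ⟨div_nonneg ht.1 hT.le, (div_le_one hT).2 ht.2⟩
  have hexp : ∀ x : ℝ, |x| ≤ exp τ * |exp (-(τ * (t / T))) * x| := fun x => by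
    rw [abs_mul, abs_of_pos (Real.exp_pos _), ← mul_assoc, ← Real.exp_add]
    refine le_mul_of_one_le_left (abs_nonneg x) (Real.one_le_exp ?_)
    nlinarith [hθ.2]
  have hu := hY ⟨t / T, hθ⟩
  have hv := W.norm_coe_le_norm ⟨t / T, hθ⟩
  change |exp (-(τ * (t / T))) * v (T * (t / T))| ≤ N at hv
  simp only [mul_div_cancel₀ t hT.ne'] at hu hv
  constructor
  · refine (hexp _).trans ?_
    rw [mul_comm 2, mul_assoc]
    gcongr
    refine le_of_mul_le_mul_left (hu.trans ?_) hlam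
    nlinarith [mul_nonneg hlam.le (abs_nonneg (u 0))]
  · refine (hexp _).trans ?_
    rw [mul_comm 2, mul_assoc]
    gcongr
    exact hv.trans hN

end Mode

section Bootstrap

open unitInterval

lemma continuous_rescaled {T : ℝ} {f : ℝ → ℝ} (hf : ContinuousOn f (Icc 0 T)) (τ : ℝ) {s : ℝ}
    (hs : s ∈ Ioc 0 T) : Continuous fun θ : I => exp (-(τ * θ)) * f (s * θ) :=
  (by fun_prop : Continuous fun θ : I => exp (-(τ * θ))).mul
    (continuous_dilation continuous_subtype_val (fun θ => θ.2) hf hs)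

lemma abs_rescaled_le {T M τ : ℝ} (hτ : 0 ≤ τ) {f : ℝ → ℝ} (hM : ∀ t ∈ Icc 0 T, |f t| ≤ M)
    {s : ℝ} (hs : s ∈ Ioc 0 T) (θ : I) : |exp (-(τ * θ)) * f (s * θ)| ≤ M := by
  rw [abs_mul, abs_of_pos (Real.exp_pos _)]
  refine (mul_le_of_le_one_left (abs_nonneg _) ?_).trans
    (hM _ (dilation_mem (p := fun θ : I => (θ : ℝ)) (fun θ => θ.2) hs θ))
  rw [Real.exp_le_one_iff]
  have := mul_nonneg hτ θ.2.1
  linarith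

lemma paramBound_rescaled_zero {T M τ : ℝ} (hτ : 0 ≤ τ) {f : ℝ → ℝ}
    (hf : ContinuousOn f (Icc 0 T)) (hM : ∀ t ∈ Icc 0 T, |f t| ≤ M) :
    ParamBound T 0 (fun _ => M) (fun s (θ : I) => exp (-(τ * θ)) * f (s * θ)) := by
  refine ParamBound.zero ?_ (fun s hs θ => abs_rescaled_le hτ hM hs θ) fun s hs => ?_
  · exact ContinuousOn.mul (by fun_prop)
      (continuousOn_dilation continuous_subtype_val (fun θ => θ.2) hf)
  · exact (abs_nonneg _).trans (abs_rescaled_le hτ hM hs 0)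

lemma exists_eulerBound_rescaled {T M τ : ℝ} {j : ℕ} (hτ : 0 ≤ τ) {u v : ℝ → ℝ} {w : ℝ → ℝ}
    (huv : ∀ t ∈ Icc 0 T, HasDerivWithinAt u (v t) (Icc 0 T) t)
    (hM : ∀ t ∈ Icc 0 T, |u t| ≤ M)
    (hv : ParamBound T j w (fun s (θ : I) => exp (-(τ * θ)) * v (s * θ))) :
    ∃ F G : ℝ → C(I, ℝ), (∀ s ∈ Ioc 0 T, ∀ θ, F s θ = exp (-(τ * θ)) * u (s * θ)) ∧
      (∀ t ∈ Ioc 0 T, ‖F t‖ ≤ M) ∧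
      (∀ t ∈ Ioc 0 T, HasDerivWithinAt F (t⁻¹ • G t) (Ioc 0 T) t) ∧
      EulerBound T j (fun t => 2 ^ j * (t * w t)) G := by
  classical
  have huc : ContinuousOn u (Icc 0 T) := fun t ht => (huv t ht).continuousWithinAt
  obtain ⟨G, hG, hG'⟩ := (paramBound_dilation_id (K := I) continuous_subtype_val
    (fun θ => θ.2) j).mul hv
  set F : ℝ → C(I, ℝ) := fun s => if h : s ∈ Ioc 0 T then ⟨_, continuous_rescaled huc τ h⟩ else 0
    with hF
  have hFu : ∀ s ∈ Ioc 0 T, ∀ θ, F s θ = exp (-(τ * θ)) * u (s * θ) := fun s hs θ => by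
    rw [hF]
    simp only [dif_pos hs, ContinuousMap.coe_mk]
  refine ⟨F, G, hFu, fun t ht => ?_, fun t ht =>
    ContinuousMap.hasDerivWithinAt_of_pointwise (fun s hs θ => ?_) hG.continuousOn ht, hG⟩
  · refine (ContinuousMap.norm_le _ ?_).2 fun θ => ?_
    · exact (abs_nonneg _).trans (abs_rescaled_le hτ hM ht 0)
    · rw [hFu t ht]
      exact abs_rescaled_le hτ hM ht θ
  · rw [hG' s hs]
    have h1 := (hasDerivWithinAt_dilation (p := fun θ : I => (θ : ℝ)) (fun θ => θ.2) hs (x := θ)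
      (huv _ (dilation_mem (p := fun θ : I => (θ : ℝ)) (fun θ => θ.2) hs θ))).const_mul
      (exp (-(τ * θ)))
    refine (h1.congr (fun r hr => hFu r hr θ) (hFu s hs θ)).congr_deriv ?_
    ring

variable {T : ℝ} {a α : ℝ → ℝ} {τ C : ℝ} {m : ℕ} {S : ℝ → C(I, ℝ) →L[ℝ] C(I, ℝ)}

lemma exists_paramBound_rescaled_mode (hT : 0 < T) (hτ : 0 < τ)
    (hS : EulerBound T m (fun _ => C) S) (hsmall : ∀ t ∈ Ioc 0 T, ‖S t‖ ≤ 1 / 4)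
    (hrep : ∀ (v : ℝ → ℝ) (w : C(I, ℝ)), ∀ s ∈ Ioc 0 T,
      (∀ θ : I, w θ = exp (-(τ * θ)) * v (s * θ)) → ∀ θ : I, 0 < θ →
        S s w θ = exp (-(τ * θ)) * (a (s * θ) *
          ∫ r in (0:ℝ)..(s * θ), v r * (s * θ - r) ^ (-(α (s * θ)))))
    {lam₀ : ℝ} (hlam₀ : 0 < lam₀) :
    ∀ j ≤ m, ∃ c, 0 ≤ c ∧ ∀ lam ≥ lam₀, ∀ u v : ℝ → ℝ, IsFractionalMode T a α lam u v →
      ParamBound T j (fun _ => c * (lam ^ (j + 1) * |u 0|))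
        (fun s (θ : I) => exp (-(τ * θ)) * v (s * θ)) := by
  obtain ⟨D, hD0, hD⟩ := hS.exists_resolvent fun t ht => (hsmall t ht).trans (by norm_num)
  have hbd : ∀ lam ≥ lam₀, ∀ u v : ℝ → ℝ, IsFractionalMode T a α lam u v → ∀ t ∈ Icc 0 T,
      |u t| ≤ 2 * exp τ * |u 0| ∧ |v t| ≤ 2 * exp τ * (lam * |u 0|) := fun lam hl u v h =>
    h.bound hT (hlam₀.trans_le hl) hτ (hsmall T ⟨hT, le_rfl⟩)
      fun w hw => hrep v w T ⟨hT, le_rfl⟩ hw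
  intro j
  induction j with
  | zero =>
    refine fun _ => ⟨2 * exp τ, by positivity, fun lam hl u v h => ?_⟩
    simpa using paramBound_rescaled_zero hτ.le h.continuousOn_deriv fun t ht =>
      (hbd lam hl u v h t ht).2
  | succ j ih =>
    intro hj
    obtain ⟨c, hc, H⟩ := ih (by omega)
    refine ⟨D * (2 * exp τ * (lam₀⁻¹) ^ (j + 1) + 2 ^ j * (T * c)), by positivity,
      fun lam hl u v h => ?_⟩
    have hlam : 0 < lam := hlam₀.trans_le hl
    have hV := H lam hl u v h
    obtain ⟨F, G, hF, hFM, hFG, hG⟩ := exists_eulerBound_rescaled hτ.le h.hasDeriv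
      (fun t ht => (hbd lam hl u v h t ht).1) hV
    set w := (2 * exp τ * (lam₀⁻¹) ^ (j + 1) + 2 ^ j * (T * c)) * (lam ^ (j + 1) * |u 0|) with hw
    have h1 : |u 0| ≤ (lam₀⁻¹) ^ (j + 1) * (lam ^ (j + 1) * |u 0|) := by
      rw [← mul_assoc, ← mul_pow]
      refine le_mul_of_one_le_left (abs_nonneg _) (one_le_pow₀ ?_)
      rw [inv_mul_eq_div, one_le_div hlam₀]
      exact hl
    have hU : EulerBound T (j + 1) (fun _ => w) F := by
      refine ⟨fun t ht => (hFM t ht).trans ?_, G, hFG, hG.mono fun t ht => ?_⟩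
      · rw [hw, add_mul]
        refine le_add_of_le_of_nonneg ?_ (by positivity)
        rw [mul_assoc (2 * exp τ)]
        gcongr
      · rw [hw, add_mul]
        refine le_add_of_nonneg_of_le (by positivity) ?_
        have := ht.2
        calc 2 ^ j * (t * (c * (lam ^ (j + 1) * |u 0|)))
            ≤ 2 ^ j * (T * (c * (lam ^ (j + 1) * |u 0|))) := by gcongr
          _ = _ := by ring
    obtain ⟨V, -, hVv⟩ := hV
    have hres := hD (j + 1) hj _ V _ (hU.const_smul (-lam)) fun t ht =>
      h.rescaled_equation ht (hVv t ht) (hF t ht) (hrep v _ t ht (hVv t ht))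
    refine ⟨V, hres.mono fun t ht => le_of_eq ?_, hVv⟩
    rw [hw, abs_neg, abs_of_pos hlam]
    ring

lemma exists_eulerBound_deriv_mode (hT : 0 < T) (hτ : 0 < τ) (hC : 0 ≤ C)
    (hα0 : 0 ≤ α 0) (hα1 : α 0 ≤ 1)
    (hS : EulerBound T (m + 1) (fun t => C * t ^ (1 - α 0)) S)
    (hsmall : ∀ t ∈ Ioc 0 T, ‖S t‖ ≤ 1 / 4)
    (hrep : ∀ (v : ℝ → ℝ) (w : C(I, ℝ)), ∀ s ∈ Ioc 0 T,
      (∀ θ : I, w θ = exp (-(τ * θ)) * v (s * θ)) → ∀ θ : I, 0 < θ →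
        S s w θ = exp (-(τ * θ)) * (a (s * θ) *
          ∫ r in (0:ℝ)..(s * θ), v r * (s * θ - r) ^ (-(α (s * θ)))))
    {lam₀ : ℝ} (hlam₀ : 0 < lam₀) :
    ∃ c, 0 ≤ c ∧ ∀ lam ≥ lam₀, ∀ u v : ℝ → ℝ, IsFractionalMode T a α lam u v →
      ∃ g : ℝ → ℝ, (∀ t ∈ Ioc 0 T, HasDerivWithinAt v (t⁻¹ * g t) (Ioc 0 T) t) ∧
        EulerBound T m (fun t => c * (lam ^ (m + 2) * |u 0|) * t ^ (1 - α 0)) g := by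
  have hS' : EulerBound T (m + 1) (fun _ => C * T ^ (1 - α 0)) S := hS.mono fun t ht => by
    have := Real.rpow_le_rpow ht.1.le ht.2 (by linarith : 0 ≤ 1 - α 0)
    gcongr
  have hboot := exists_paramBound_rescaled_mode hT hτ hS' hsmall hrep hlam₀
  obtain ⟨c₁, hc₁, H₁⟩ := hboot m (by omega)
  obtain ⟨c₂, hc₂, H₂⟩ := hboot (m + 1) le_rfl
  set E : C(I, ℝ) →L[ℝ] ℝ := exp τ • ContinuousMap.evalCLM ℝ (1 : I) with hE
  refine ⟨‖E‖ * (2 ^ m * (T ^ α 0 * c₁) + 2 ^ (m + 1) * (C * c₂)), by positivity,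
    fun lam hl u v h => ?_⟩
  have hlam : 0 < lam := hlam₀.trans_le hl
  have hbd := h.bound hT hlam hτ (hsmall T ⟨hT, le_rfl⟩) fun w hw => hrep v w T ⟨hT, le_rfl⟩ hw
  obtain ⟨F, G, hF, -, hFG, hG⟩ := exists_eulerBound_rescaled hτ.le h.hasDeriv
    (fun t ht => (hbd t ht).1) (H₁ lam hl u v h)
  obtain ⟨V, hV, hVv⟩ := H₂ lam hl u v h
  obtain ⟨-, G', hG'd, hG'⟩ := hS.clm_apply hV
  have hVeq : ∀ t ∈ Ioc 0 T, V t = (-lam) • F t - S t (V t) := fun t ht =>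
    eq_sub_of_add_eq (h.rescaled_equation ht (hVv t ht) (hF t ht) (hrep v _ t ht (hVv t ht)))
  have hR : EulerBound T m (fun t => (2 ^ m * (T ^ α 0 * c₁) + 2 ^ (m + 1) * (C * c₂)) *
      (lam ^ (m + 2) * |u 0|) * t ^ (1 - α 0)) (fun t => (-lam) • G t + (-1 : ℝ) • G' t) := by
    refine ((hG.const_smul (-lam)).add (hG'.const_smul (-1))).mono fun t ht => ?_
    have h0 := Real.rpow_nonneg ht.1.le (1 - α 0)
    have ht' : t ≤ T ^ α 0 * t ^ (1 - α 0) := by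
      calc t = t ^ α 0 * t ^ (1 - α 0) := by rw [← Real.rpow_add ht.1]; simp
        _ ≤ _ := by gcongr; exacts [ht.1.le, ht.2]
    have h1 : |-lam| * (2 ^ m * (t * (c₁ * (lam ^ (m + 1) * |u 0|)))) ≤
        2 ^ m * (T ^ α 0 * c₁) * (lam ^ (m + 2) * |u 0|) * t ^ (1 - α 0) := by
      rw [abs_neg, abs_of_pos hlam]
      calc lam * (2 ^ m * (t * (c₁ * (lam ^ (m + 1) * |u 0|))))
          ≤ lam * (2 ^ m * (T ^ α 0 * t ^ (1 - α 0) * (c₁ * (lam ^ (m + 1) * |u 0|)))) := by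
            gcongr
        _ = _ := by ring
    refine (add_le_add_left h1 _).trans (le_of_eq ?_)
    rw [abs_neg, abs_one]
    ring
  refine ⟨fun t => E ((-lam) • G t + (-1 : ℝ) • G' t), fun t ht => ?_,
    (hR.clm_comp E).mono fun t ht => le_of_eq (by ring)⟩
  have hVd : HasDerivWithinAt V (t⁻¹ • ((-lam) • G t + (-1 : ℝ) • G' t)) (Ioc 0 T) t := by
    refine ((((hFG t ht).const_smul (-lam)).sub (hG'd t ht)).congr hVeq
      (hVeq t ht)).congr_deriv ?_
    module
  have hvV : ∀ s ∈ Ioc 0 T, v s = E (V s) := fun s hs => by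
    simp [hE, hVv s hs, ← mul_assoc, ← Real.exp_add]
  refine ((E.hasFDerivAt.comp_hasDerivWithinAt t hVd).congr hvV (hvV t ht)).congr_deriv ?_
  rw [map_smul, smul_eq_mul]

end Bootstrap

section Conclusion

lemma contDiffOn_succ_of_hasDerivWithinAt {T : ℝ} {m : ℕ} {f g : ℝ → ℝ}
    (hfg : ∀ t ∈ Ioc 0 T, HasDerivWithinAt f (g t) (Ioc 0 T) t)
    (hg : ContDiffOn ℝ m g (Ioc 0 T)) : ContDiffOn ℝ (m + 1 : ℕ) f (Ioc 0 T) := by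
  push_cast
  refine (contDiffOn_succ_iff_derivWithin (uniqueDiffOn_Ioc 0 T)).2
    ⟨fun t ht => (hfg t ht).differentiableWithinAt, by simp, hg.congr fun t ht => ?_⟩
  exact (hfg t ht).derivWithin (uniqueDiffOn_Ioc 0 T t ht)

lemma iteratedDerivWithin_succ_of_hasDerivWithinAt {T : ℝ} (j : ℕ) {f g : ℝ → ℝ}
    (hfg : ∀ t ∈ Ioc 0 T, HasDerivWithinAt f (g t) (Ioc 0 T) t) {t : ℝ} (ht : t ∈ Ioc 0 T) :
    iteratedDerivWithin (j + 1) f (Ioc 0 T) t = iteratedDerivWithin j g (Ioc 0 T) t := by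
  rw [iteratedDerivWithin_succ']
  exact iteratedDerivWithin_congr
    (fun s hs => (hfg s hs).derivWithin (uniqueDiffOn_Ioc 0 T s hs)) ht

theorem exists_mode_bound {T : ℝ} (hT : 0 < T) {a α : ℝ → ℝ} {αstar : ℝ}
    (hαstar : αstar < 1) (hα : ∀ t ∈ Icc 0 T, 0 ≤ α t ∧ α t ≤ αstar)
    (hlim : ∃ ℓ : ℝ, Tendsto (fun t => (α t - α 0) * Real.log t)
      (nhdsWithin 0 (Ioi 0)) (nhds ℓ))
    {m : ℕ} (ham : ContDiffOn ℝ (m + 1 : ℕ) a (Icc 0 T))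
    (hαm : ContDiffOn ℝ (m + 1 : ℕ) α (Icc 0 T)) {lam₀ : ℝ} (hlam₀ : 0 < lam₀) :
    ∃ Q : ℝ, 0 < Q ∧ ∀ lam ≥ lam₀, ∀ u v : ℝ → ℝ, IsFractionalMode T a α lam u v →
      ContDiffOn ℝ (m + 2 : ℕ) u (Ioc 0 T) ∧
      (∀ t ∈ Icc 0 T, |u t| ≤ Q * (lam ^ (m + 2) * |u 0|) ∧
        |v t| ≤ Q * (lam ^ (m + 2) * |u 0|)) ∧
      ∀ j ≤ m, ∀ t ∈ Ioc 0 T, t ^ (j + α 0) * |iteratedDerivWithin (j + 2) u (Ioc 0 T) t| ≤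
        Q * (lam ^ (m + 2) * |u 0|) := by
  have hα0 := hα 0 ⟨le_rfl, hT.le⟩
  obtain ⟨τ, hτ, C, hC, S, hS, hsmall, hrep⟩ :=
    exists_rescaled_operator hT hαstar hα hlim ham hαm
  obtain ⟨c, hc, H⟩ := exists_eulerBound_deriv_mode hT hτ hC hα0.1 (hα0.2.trans hαstar.le) hS
    hsmall hrep hlam₀
  set Q₁ := 2 * exp τ * ((lam₀⁻¹) ^ (m + 2) + (lam₀⁻¹) ^ (m + 1)) with hQ₁
  set Q₂ := 2 ^ (m * m) * (2 ^ m * c) with hQ₂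
  have hQ₁0 : 0 < Q₁ := by positivity
  have hQ₂0 : 0 ≤ Q₂ := by positivity
  refine ⟨Q₁ + Q₂, by positivity, fun lam hl u v h => ?_⟩
  have hlam : 0 < lam := hlam₀.trans_le hl
  set N := lam ^ (m + 2) * |u 0| with hN
  have hN0 : 0 ≤ N := by positivity
  have hone : 1 ≤ lam₀⁻¹ * lam := by rw [inv_mul_eq_div, one_le_div hlam₀]; exact hl
  have hbd := h.bound hT hlam hτ (hsmall T ⟨hT, le_rfl⟩) fun w hw => hrep v w T ⟨hT, le_rfl⟩ hw
  obtain ⟨g, hg, hgE⟩ := H lam hl u v h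
  have huv : ∀ t ∈ Ioc 0 T, HasDerivWithinAt u (v t) (Ioc 0 T) t := fun t ht =>
    (h.hasDeriv t (Ioc_subset_Icc_self ht)).mono Ioc_subset_Icc_self
  obtain ⟨hcd, hit⟩ := (EulerBound.inv_real.smul hgE).iteratedDerivWithin_bound
  simp only [smul_eq_mul] at hcd hit
  refine ⟨contDiffOn_succ_of_hasDerivWithinAt huv (contDiffOn_succ_of_hasDerivWithinAt hg hcd),
    fun t ht => ⟨?_, ?_⟩, fun j hj t ht => ?_⟩
  · have h1 : |u 0| ≤ (lam₀⁻¹) ^ (m + 2) * N := by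
      rw [hN, ← mul_assoc, ← mul_pow]
      exact le_mul_of_one_le_left (abs_nonneg _) (one_le_pow₀ hone)
    calc |u t| ≤ 2 * exp τ * |u 0| := (hbd t ht).1
      _ ≤ 2 * exp τ * ((lam₀⁻¹) ^ (m + 2) * N) := by gcongr
      _ ≤ 2 * exp τ * ((lam₀⁻¹) ^ (m + 2) * N) + 2 * exp τ * ((lam₀⁻¹) ^ (m + 1) * N) + Q₂ * N :=
        by linarith [show 0 ≤ 2 * exp τ * ((lam₀⁻¹) ^ (m + 1) * N) + Q₂ * N by positivity]
      _ = (Q₁ + Q₂) * N := by rw [hQ₁]; ring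
  · have h1 : lam * |u 0| ≤ (lam₀⁻¹) ^ (m + 1) * N := by
      rw [hN, show (lam₀⁻¹) ^ (m + 1) * (lam ^ (m + 2) * |u 0|) =
        (lam₀⁻¹ * lam) ^ (m + 1) * (lam * |u 0|) by ring]
      exact le_mul_of_one_le_left (by positivity) (one_le_pow₀ hone)
    calc |v t| ≤ 2 * exp τ * (lam * |u 0|) := (hbd t ht).2
      _ ≤ 2 * exp τ * ((lam₀⁻¹) ^ (m + 1) * N) := by gcongr
      _ ≤ 2 * exp τ * ((lam₀⁻¹) ^ (m + 2) * N) + 2 * exp τ * ((lam₀⁻¹) ^ (m + 1) * N) + Q₂ * N :=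
        by linarith [show 0 ≤ 2 * exp τ * ((lam₀⁻¹) ^ (m + 2) * N) + Q₂ * N by positivity]
      _ = (Q₁ + Q₂) * N := by rw [hQ₁]; ring
  · rw [iteratedDerivWithin_succ_of_hasDerivWithinAt (j + 1) huv ht,
      iteratedDerivWithin_succ_of_hasDerivWithinAt j hg ht]
    have ht0 := ht.1
    have h1 : t ^ (j + α 0) * (t⁻¹ * t ^ (1 - α 0) * t⁻¹ ^ j) = 1 := by
      rw [← Real.rpow_neg_one, ← Real.rpow_natCast, ← Real.rpow_mul ht0.le,
        ← Real.rpow_add ht0, ← Real.rpow_add ht0, ← Real.rpow_add ht0]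
      ring_nf
      simp
    calc t ^ (j + α 0) * |iteratedDerivWithin j (fun t => t⁻¹ * g t) (Ioc 0 T) t|
        ≤ t ^ (j + α 0) * (2 ^ (m * j) *
          (2 ^ m * (t⁻¹ * (c * N * t ^ (1 - α 0))) * t⁻¹ ^ j)) := by
          gcongr
          exact hit j hj t ht
      _ = 2 ^ (m * j) * (2 ^ m * c) * N *
          (t ^ (j + α 0) * (t⁻¹ * t ^ (1 - α 0) * t⁻¹ ^ j)) := by ring
      _ = 2 ^ (m * j) * (2 ^ m * c) * N := by rw [h1, mul_one]
      _ ≤ Q₂ * N := by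
          rw [hQ₂]
          gcongr
          norm_num
      _ ≤ (Q₁ + Q₂) * N := by
          gcongr
          linarith

lemma summable_and_tsum_le_of_abs_le {lam f x : ℕ → ℝ} {γ Q : ℝ} {n : ℕ} (hlam : ∀ i, 0 < lam i)
    (hsum : Summable fun i => lam i ^ (γ + 2 * (n : ℝ)) * (x i) ^ 2)
    (hf : ∀ i, |f i| ≤ Q * (lam i ^ n * |x i|)) :
    Summable (fun i => lam i ^ γ * (f i) ^ 2) ∧
      ∑' i, lam i ^ γ * (f i) ^ 2 ≤ Q ^ 2 * ∑' i, lam i ^ (γ + 2 * (n : ℝ)) * (x i) ^ 2 := by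
  have hle : ∀ i, lam i ^ γ * (f i) ^ 2 ≤
      Q ^ 2 * (lam i ^ (γ + 2 * (n : ℝ)) * (x i) ^ 2) := fun i => by
    have h1 := Real.rpow_nonneg (hlam i).le γ
    have h2 : lam i ^ (2 * (n : ℝ)) = (lam i ^ n) ^ 2 := by
      rw [← pow_mul, ← Real.rpow_natCast]
      push_cast
      ring_nf
    calc lam i ^ γ * (f i) ^ 2 = lam i ^ γ * |f i| ^ 2 := by rw [sq_abs]
      _ ≤ lam i ^ γ * (Q * (lam i ^ n * |x i|)) ^ 2 := by gcongr; exact hf i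
      _ = Q ^ 2 * (lam i ^ (γ + 2 * (n : ℝ)) * (x i) ^ 2) := by
        rw [Real.rpow_add (hlam i), h2, ← sq_abs (x i)]
        ring
  have hnn : ∀ i, 0 ≤ lam i ^ γ * (f i) ^ 2 := fun i =>
    mul_nonneg (Real.rpow_nonneg (hlam i).le γ) (sq_nonneg _)
  have hs := Summable.of_nonneg_of_le hnn hle (hsum.mul_left (Q ^ 2))
  refine ⟨hs, ?_⟩
  rw [← tsum_mul_left]
  exact hs.tsum_le_tsum hle (hsum.mul_left (Q ^ 2))

lemma contDiff_inv_Gamma {m : ℕ} : ContDiff ℝ m fun x : ℝ => 1 / Real.Gamma x := by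
  have h : ContDiff ℝ m fun x : ℝ => ((Complex.Gamma x)⁻¹).re :=
    (Complex.differentiable_one_div_Gamma.contDiff (n := m)).real_of_complex
  convert h using 2 with x
  rw [Complex.Gamma_ofReal, ← Complex.ofReal_inv, Complex.ofReal_re, one_div]

end Conclusion

/-- Spectral form of the singular-regularity case of Theorem 3.2: under Assumption A, if
`α, k ∈ C^{n-1}[0,T]`, `α(0) > 0`, and the data `(u₀ᵢ)` is in `H^{γ+2n}`, then each mode is
`C^n((0,T])` and the weighted bounds corresponding to the `C^n_{1-α(0)}((0,T];H^γ)` norm hold: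
the `H^γ` norms of `u` and `u'` are bounded on `[0,T]`, and for `2 ≤ l ≤ n` the weighted
quantity `t^{l-2+α(0)} ‖∂ₜˡ u‖_{H^γ}` is bounded on `(0,T]`, all by `Q ‖u₀‖_{H^{γ+2n}}` with `Q`
independent of the data. Modes are indexed so that `lam i` is `λ_{i+1} = K (i+1)² π²/L²`. -/
theorem singular_regularity_spectral
    (n : ℕ) (hn : 2 ≤ n)
    (T K L αstar γ : ℝ) (α k : ℝ → ℝ)
    (hT : 0 < T) (hK : 0 < K) (hL : 0 < L)
    (hαcont : ContinuousOn α (Icc 0 T)) (hkcont : ContinuousOn k (Icc 0 T))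
    (hαstar0 : 0 < αstar) (hαstar1 : αstar < 1)
    (hαbdd : ∀ t ∈ Icc 0 T, 0 ≤ α t ∧ α t ≤ αstar)
    (hlim : ∃ ℓ : ℝ, Tendsto (fun t => (α t - α 0) * Real.log t)
      (nhdsWithin 0 (Ioi 0)) (nhds ℓ))
    (hαsmooth : ContDiffOn ℝ (n - 1) α (Icc 0 T))
    (hksmooth : ContDiffOn ℝ (n - 1) k (Icc 0 T))
    (hα0pos : 0 < α 0)
    (hγ : 1/2 < γ)
    (lam : ℕ → ℝ) (hlam : ∀ i, lam i = K * ((i : ℝ) + 1)^2 * π^2 / L^2) :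
    ∃ Q : ℝ, 0 < Q ∧
      ∀ (u₀ : ℕ → ℝ) (u : ℕ → ℝ → ℝ),
        Summable (fun i => lam i ^ (γ + 2 * (n : ℝ)) * (u₀ i)^2) →
        (∀ i, ContDiffOn ℝ 1 (u i) (Icc 0 T) ∧ u i 0 = u₀ i ∧
          ∀ t ∈ Ioc 0 T,
            derivWithin (u i) (Icc 0 T) t
              + k t * caputo α (derivWithin (u i) (Icc 0 T)) t = -(lam i) * u i t) →
        (∀ i, ContDiffOn ℝ n (u i) (Ioc 0 T)) ∧
        (∀ t ∈ Icc 0 T,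
          (Summable (fun i => lam i ^ γ * (u i t)^2) ∧
            (∑' i, lam i ^ γ * (u i t)^2)
              ≤ Q^2 * ∑' i, lam i ^ (γ + 2 * (n : ℝ)) * (u₀ i)^2) ∧
          (Summable (fun i => lam i ^ γ * (derivWithin (u i) (Icc 0 T) t)^2) ∧
            (∑' i, lam i ^ γ * (derivWithin (u i) (Icc 0 T) t)^2)
              ≤ Q^2 * ∑' i, lam i ^ (γ + 2 * (n : ℝ)) * (u₀ i)^2)) ∧
        ∀ l, 2 ≤ l → l ≤ n → ∀ t ∈ Ioc 0 T,
          Summable (fun i => lam i ^ γ * (iteratedDerivWithin l (u i) (Ioc 0 T) t)^2) ∧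
          t ^ (2 * ((l : ℝ) - 2 + α 0)) *
              (∑' i, lam i ^ γ * (iteratedDerivWithin l (u i) (Ioc 0 T) t)^2)
            ≤ Q^2 * ∑' i, lam i ^ (γ + 2 * (n : ℝ)) * (u₀ i)^2 := by
  obtain ⟨m, rfl⟩ : ∃ m, n = m + 2 := ⟨n - 2, by omega⟩
  have hcast : (((m + 2 : ℕ) : WithTop ℕ∞) - 1) = ((m + 1 : ℕ) : WithTop ℕ∞) := by
    norm_cast
  rw [hcast] at hαsmooth hksmooth
  have ham : ContDiffOn ℝ (m + 1 : ℕ) (fun t => k t * (1 / Real.Gamma (1 - α t))) (Icc 0 T) :=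
    hksmooth.mul (contDiff_inv_Gamma.comp_contDiffOn (contDiffOn_const.sub hαsmooth))
  have hlam₀ : 0 < lam 0 := by
    rw [hlam]
    positivity
  have hlam_le : ∀ i, lam 0 ≤ lam i := fun i => by
    rw [hlam, hlam]
    gcongr
    exact Nat.zero_le i
  have hlam_pos : ∀ i, 0 < lam i := fun i => hlam₀.trans_le (hlam_le i)
  obtain ⟨Q, hQ, H⟩ := exists_mode_bound hT hαstar1 hαbdd hlim ham hαsmooth hlam₀
  refine ⟨Q, hQ, fun u₀ u hsum hu => ?_⟩
  have hmode : ∀ i, IsFractionalMode T (fun t => k t * (1 / Real.Gamma (1 - α t))) α (lam i)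
      (u i) (derivWithin (u i) (Icc 0 T)) := fun i => by
    obtain ⟨hc, -, heq⟩ := hu i
    refine ⟨fun t ht => ((hc.differentiableOn one_ne_zero) t ht).hasDerivWithinAt,
      hc.continuousOn_derivWithin (uniqueDiffOn_Icc hT) le_rfl, fun t ht => ?_⟩
    rw [← heq t ht, caputo, mul_assoc]
  have hbd := fun i => H (lam i) (hlam_le i) (u i) _ (hmode i)
  simp only [(hu _).2.1] at hbd
  refine ⟨fun i => (hbd i).1, fun t ht => ⟨?_, ?_⟩, fun l hl hln t ht => ?_⟩
  · exact summable_and_tsum_le_of_abs_le hlam_pos hsum fun i => ((hbd i).2.1 t ht).1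
  · exact summable_and_tsum_le_of_abs_le hlam_pos hsum fun i => ((hbd i).2.1 t ht).2
  · obtain ⟨j, rfl⟩ : ∃ j, l = j + 2 := ⟨l - 2, by omega⟩
    set p := t ^ (j + α 0) with hp
    have hp0 : 0 < p := Real.rpow_pos_of_pos ht.1 _
    have hp2 : t ^ (2 * (((j + 2 : ℕ) : ℝ) - 2 + α 0)) = p ^ 2 := by
      rw [hp, ← Real.rpow_natCast (t ^ _) 2, ← Real.rpow_mul ht.1.le]
      push_cast
      ring_nf
    obtain ⟨h1, h2⟩ := summable_and_tsum_le_of_abs_le (Q := Q / p) hlam_pos hsum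
      (f := fun i => iteratedDerivWithin (j + 2) (u i) (Ioc 0 T) t) fun i => by
        rw [div_mul_eq_mul_div, le_div_iff₀ hp0, mul_comm]
        exact (hbd i).2.2 j (by omega) t ht
    refine ⟨h1, ?_⟩
    rw [hp2]
    refine (mul_le_mul_of_nonneg_left h2 (sq_nonneg p)).trans (le_of_eq ?_)
    field_simp
end

section
/- Let T > 0, let k : [0,T] → ℝ be continuous with k(0) ≠ 0, let α, α̂ : [0,T] → ℝ be real-analytic on [0,T] with 0 ≤ α(t) ≤ α* < 1 and 0 ≤ α̂(t) ≤ α* < 1 for all t, and suppose both satisfy the limit condition of Assumption A. Let λ > 0 and u₀ ≠ 0, and let u ∈ C¹([0,T]) with u(0) = u₀ satisfy both u'(t) + k(t)·D^{α(t)}u(t) = −λ·u(t) and u'(t) + k(t)·D^{α̂(t)}u(t) = −λ·u(t) for all t ∈ (0,T]. Then α(t) = α̂(t) for all t ∈ [0,T]. -/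
open Real Set Filter

/-- For small `τ`, the normalized Caputo kernel is strictly increasing in the order. -/
theorem exists_strictMonoOn_caputo_kernel {b : ℝ} (hb : b < 1) :
    ∃ δ > 0, ∀ τ ∈ Ioo 0 δ,
      StrictMonoOn (fun a => 1 / Real.Gamma (1 - a) * τ ^ (-a)) (Iic b) := by
  set p := (1 - b) / 4
  set q := (1 - b) / 2
  have hp : 0 < p := by simp only [p]; linarith
  have hpq : p < q := by simp only [p, q]; linarith
  set C := ((log ∘ Real.Gamma) q - (log ∘ Real.Gamma) p) / (q - p)
  refine ⟨exp C, exp_pos C, fun τ hτ x hx y hy hxy => ?_⟩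
  rw [mem_Iic] at hx hy
  have hqy : q < 1 - y := by simp only [q]; linarith
  have h1 := Real.convexOn_log_Gamma.slope_mono_adjacent (x := p) (y := q) (z := 1 - y)
    hp (show 0 < 1 - y by linarith) hpq hqy
  have h2 := Real.convexOn_log_Gamma.slope_mono_adjacent (x := q) (y := 1 - y) (z := 1 - x)
    (show 0 < q by linarith) (show 0 < 1 - x by linarith) hqy (by linarith)
  have h3 := h1.trans h2
  rw [le_div_iff₀ (by linarith)] at h3
  have hlog : log τ < C := (log_lt_iff_lt_exp hτ.1).2 hτ.2
  have hker : ∀ a < 1, 1 / Real.Gamma (1 - a) * τ ^ (-a) =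
      exp (-(log ∘ Real.Gamma) (1 - a) - a * log τ) := by
    intro a ha
    rw [rpow_def_of_pos hτ.1, sub_eq_add_neg (-_), exp_add, Function.comp_apply, exp_neg,
      exp_log (Real.Gamma_pos_of_pos (by linarith)), one_div]
    congr 2
    ring
  simp only
  rw [hker x (by linarith), hker y (by linarith), exp_lt_exp]
  nlinarith [mul_pos (sub_pos.2 hxy) (sub_pos.2 hlog)]

theorem intervalIntegrable_caputo_integrand {g : ℝ → ℝ} {t a : ℝ} (ht : 0 ≤ t)
    (hg : ContinuousOn g (Icc 0 t)) (ha : a < 1) :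
    IntervalIntegrable (fun s => g s * (t - s) ^ (-a)) MeasureTheory.volume 0 t := by
  have h := (intervalIntegral.intervalIntegrable_rpow' (a := t) (b := 0) (r := -a)
    (by linarith)).comp_sub_left t
  simp only [sub_self, sub_zero] at h
  exact h.continuousOn_mul (by rwa [uIcc_of_le ht])

theorem integral_sub_rpow_neg {t a : ℝ} (ha : a < 1) :
    ∫ s in (0:ℝ)..t, (t - s) ^ (-a) = t ^ (1 - a) / (1 - a) := by
  rw [intervalIntegral.integral_comp_sub_left (fun x => x ^ (-a)), sub_self, sub_zero,
    integral_rpow (Or.inl (by linarith)), neg_add_eq_sub,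
    zero_rpow (by linarith), sub_zero]

/-- If `g` has constant sign on `(0,t)` and `t` is small, the Caputo derivative at `t` determines
the order at `t`. -/
theorem caputo_ne_of_lt {g α β : ℝ → ℝ} {t b c : ℝ} (ht : 0 < t) (hb : b < 1)
    (hker : ∀ τ ∈ Ioc 0 t, StrictMonoOn (fun a => 1 / Real.Gamma (1 - a) * τ ^ (-a)) (Iic b))
    (hg : ContinuousOn g (Icc 0 t)) (hc : ∀ s ∈ Ioo 0 t, 0 < c * g s)
    (hβ : β t ≤ b) (hαβ : α t < β t) : caputo α g t ≠ caputo β g t := by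
  intro h
  have hα : α t ≤ b := hαβ.le.trans hβ
  have iα := (intervalIntegrable_caputo_integrand ht.le hg
    (hα.trans_lt hb)).const_mul (1 / Real.Gamma (1 - α t))
  have iβ := (intervalIntegrable_caputo_integrand ht.le hg
    (hβ.trans_lt hb)).const_mul (1 / Real.Gamma (1 - β t))
  have hpos := intervalIntegral.intervalIntegral_pos_of_pos_on ((iβ.sub iα).const_mul c)
    (fun s hs => by
      have hk := hker (t - s) ⟨by linarith [hs.2], by linarith [hs.1]⟩ hα hβ hαβ
      have := mul_pos (hc s hs) (sub_pos.2 hk)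
      simp only at this ⊢
      linarith) ht
  rw [intervalIntegral.integral_const_mul, intervalIntegral.integral_sub iβ iα,
    intervalIntegral.integral_const_mul, intervalIntegral.integral_const_mul] at hpos
  unfold caputo at h
  rw [h, sub_self, mul_zero] at hpos
  exact hpos.false

/-- The variable-order Caputo derivative with a continuous `g` vanishes as `t → 0⁺`. -/
theorem tendsto_caputo_zero {g α : ℝ → ℝ} {T b : ℝ} (hT : 0 < T) (hb : b < 1)
    (hg : ContinuousOn g (Icc 0 T)) (hα : ∀ t ∈ Icc 0 T, α t ≤ b) :
    Tendsto (caputo α g) (nhdsWithin 0 (Ioi 0)) (nhds 0) := by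
  obtain ⟨δ, hδ, hker⟩ := exists_strictMonoOn_caputo_kernel hb
  obtain ⟨M, hM⟩ := isCompact_Icc.exists_bound_of_continuousOn hg
  have hlim : Tendsto (fun t : ℝ => M * (1 / Real.Gamma (1 - b)) * (t ^ (1 - b) / (1 - b)))
      (nhdsWithin 0 (Ioi 0)) (nhds 0) := by
    have h := (continuousAt_rpow_const 0 (1 - b) (Or.inr (by linarith))).tendsto
    rw [zero_rpow (by linarith)] at h
    simpa using ((h.mono_left nhdsWithin_le_nhds).div_const (1 - b)).const_mul
      (M * (1 / Real.Gamma (1 - b)))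
  refine squeeze_zero_norm' ?_ hlim
  filter_upwards [Ioo_mem_nhdsGT (lt_min hδ hT)] with t ht
  have htT : t ≤ T := (ht.2.trans_le (min_le_right _ _)).le
  have hαt := hα t ⟨ht.1.le, htT⟩
  have hint := intervalIntegrable_caputo_integrand (g := fun _ => 1) (a := b) ht.1.le
    continuousOn_const hb
  simp only [one_mul] at hint
  unfold caputo
  rw [← intervalIntegral.integral_const_mul, ← integral_sub_rpow_neg hb,
    ← intervalIntegral.integral_const_mul]
  refine intervalIntegral.norm_integral_le_of_norm_le ht.1.le ?_ (hint.const_mul _)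
  have hne : ∀ᵐ s : ℝ, s ≠ t := MeasureTheory.Measure.ae_ne _ t
  filter_upwards [hne] with s hst hs
  have hs' : s < t := lt_of_le_of_ne hs.2 hst
  have hk := (hker (t - s) ⟨by linarith, by linarith [hs.1, ht.2, min_le_left δ T]⟩).monotoneOn
    hαt self_mem_Iic hαt
  have hk0 : 0 ≤ 1 / Real.Gamma (1 - α t) * (t - s) ^ (-α t) :=
    mul_nonneg (one_div_nonneg.2 (Real.Gamma_pos_of_pos (by linarith)).le)
      (rpow_nonneg (by linarith) _)
  have hgM := hM s ⟨hs.1.le, hs.2.trans htT⟩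
  calc ‖1 / Real.Gamma (1 - α t) * (g s * (t - s) ^ (-α t))‖
      = ‖g s‖ * (1 / Real.Gamma (1 - α t) * (t - s) ^ (-α t)) := by
        rw [mul_left_comm, norm_mul, norm_of_nonneg hk0]
    _ ≤ M * (1 / Real.Gamma (1 - b) * (t - s) ^ (-b)) :=
        mul_le_mul hgM hk hk0 ((norm_nonneg _).trans hgM)
    _ = _ := by ring

/-- Identity theorem on a compact interval. -/
theorem AnalyticOn.eqOn_Icc_of_eventuallyEq_nhdsGT {f g : ℝ → ℝ} {a b : ℝ} (hab : a < b)
    (hf : AnalyticOn ℝ f (Icc a b)) (hg : AnalyticOn ℝ g (Icc a b))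
    (hfg : f =ᶠ[nhdsWithin a (Ioi a)] g) : EqOn f g (Icc a b) := by
  obtain ⟨c, hc, hcfg⟩ := (mem_nhdsGT_iff_exists_Ioo_subset' hab).1 hfg
  obtain ⟨x, hx⟩ := exists_between (lt_min (mem_Ioi.1 hc) hab)
  have hIoo : EqOn f g (Ioo a b) :=
    (isOpen_Ioo.analyticOn_iff_analyticOnNhd.1
      (hf.mono Ioo_subset_Icc_self)).eqOn_of_preconnected_of_eventuallyEq
      (isOpen_Ioo.analyticOn_iff_analyticOnNhd.1 (hg.mono Ioo_subset_Icc_self))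
      isPreconnected_Ioo ⟨hx.1, hx.2.trans_le (min_le_right _ _)⟩
      (mem_of_superset (Ioo_mem_nhds hx.1 (hx.2.trans_le (min_le_left _ _))) hcfg)
  exact hIoo.of_subset_closure hf.continuousOn hg.continuousOn Ioo_subset_Icc_self
    (closure_Ioo hab.ne).ge

/-- Analytic core of the uniqueness Theorem 4.2: a single nontrivial mode determines the variable
order. If `k(0) ≠ 0`, `α` and `α̂` are real-analytic on `[0,T]`, take values in `[0,α*]` with
`α* < 1`, satisfy the limit condition of Assumption A, and a single `C¹` function `u` with
`u(0) = u₀ ≠ 0` solves the mode equation with both orders, then `α ≡ α̂` on `[0,T]`. -/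
theorem variable_order_determined_by_single_mode
    (T αstar : ℝ) (hT : 0 < T) (hαstar0 : 0 < αstar) (hαstar1 : αstar < 1)
    (k : ℝ → ℝ) (hkcont : ContinuousOn k (Icc 0 T)) (hk0 : k 0 ≠ 0)
    (α αh : ℝ → ℝ)
    (hαan : AnalyticOn ℝ α (Icc 0 T)) (hαhan : AnalyticOn ℝ αh (Icc 0 T))
    (hαbdd : ∀ t ∈ Icc 0 T, 0 ≤ α t ∧ α t ≤ αstar)
    (hαhbdd : ∀ t ∈ Icc 0 T, 0 ≤ αh t ∧ αh t ≤ αstar)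
    (hlim : ∃ ℓ : ℝ, Tendsto (fun t => (α t - α 0) * Real.log t)
      (nhdsWithin 0 (Ioi 0)) (nhds ℓ))
    (hlimh : ∃ ℓ : ℝ, Tendsto (fun t => (αh t - αh 0) * Real.log t)
      (nhdsWithin 0 (Ioi 0)) (nhds ℓ))
    (lam u₀ : ℝ) (hlam : 0 < lam) (hu₀ : u₀ ≠ 0)
    (u : ℝ → ℝ) (hu : ContDiffOn ℝ 1 u (Icc 0 T)) (hu0 : u 0 = u₀)
    (heq : ∀ t ∈ Ioc 0 T,
      derivWithin u (Icc 0 T) t + k t * caputo α (derivWithin u (Icc 0 T)) t = -lam * u t)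
    (heqh : ∀ t ∈ Ioc 0 T,
      derivWithin u (Icc 0 T) t + k t * caputo αh (derivWithin u (Icc 0 T)) t = -lam * u t) :
    ∀ t ∈ Icc 0 T, α t = αh t := by
  obtain ⟨δ, hδ, hker⟩ := exists_strictMonoOn_caputo_kernel hαstar1
  set g := derivWithin u (Icc 0 T)
  have hg : ContinuousOn g (Icc 0 T) :=
    hu.continuousOn_derivWithin (uniqueDiffOn_Icc hT) le_rfl
  have hle : nhdsWithin (0 : ℝ) (Ioi 0) ≤ nhdsWithin 0 (Icc 0 T) :=
    le_inf nhdsWithin_le_nhds (le_principal_iff.2 (Icc_mem_nhdsGT hT))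
  have h0 : (0 : ℝ) ∈ Icc 0 T := left_mem_Icc.2 hT.le
  have tg := (hg 0 h0).tendsto.mono_left hle
  have tk := (hkcont 0 h0).tendsto.mono_left hle
  have tu := (hu.continuousOn 0 h0).tendsto.mono_left hle
  have tc := tendsto_caputo_zero hT hαstar1 hg fun t ht => (hαbdd t ht).2
  have hg0 : g 0 = -lam * u₀ := by
    have hl := tg.add (tk.mul tc)
    rw [mul_zero, add_zero] at hl
    rw [← hu0]
    refine tendsto_nhds_unique (hl.congr' ?_) (tu.const_mul (-lam))
    filter_upwards [Ioc_mem_nhdsGT hT] with t ht using heq t ht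
  have hg0' : 0 < g 0 * g 0 := mul_self_pos.2 (hg0 ▸ mul_ne_zero (neg_ne_zero.2 hlam.ne') hu₀)
  obtain ⟨ε, hε, hsign⟩ := (mem_nhdsGT_iff_exists_Ioo_subset' hT).1
    ((tg.const_mul (g 0)).eventually (lt_mem_nhds hg0'))
  refine hαan.eqOn_Icc_of_eventuallyEq_nhdsGT hT hαhan ?_
  filter_upwards [tk.eventually_ne hk0, Ioo_mem_nhdsGT hε, Ioo_mem_nhdsGT hδ, Ioc_mem_nhdsGT hT]
    with t hkt htε htδ htT
  have hcap : caputo α g t = caputo αh g t :=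
    mul_left_cancel₀ hkt (add_left_cancel ((heq t htT).trans (heqh t htT).symm))
  have ht : t ∈ Icc 0 T := Ioc_subset_Icc_self htT
  have hkert : ∀ τ ∈ Ioc 0 t,
      StrictMonoOn (fun a => 1 / Real.Gamma (1 - a) * τ ^ (-a)) (Iic αstar) :=
    fun τ hτ => hker τ ⟨hτ.1, hτ.2.trans_lt htδ.2⟩
  have hgt : ContinuousOn g (Icc 0 t) := hg.mono (Icc_subset_Icc_right htT.2)
  have hst : ∀ s ∈ Ioo 0 t, 0 < g 0 * g s := fun s hs => hsign ⟨hs.1, hs.2.trans htε.2⟩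
  rcases lt_trichotomy (α t) (αh t) with h | h | h
  · exact absurd hcap (caputo_ne_of_lt htT.1 hαstar1 hkert hgt hst (hαhbdd t ht).2 h)
  · exact h
  · exact absurd hcap.symm (caputo_ne_of_lt htT.1 hαstar1 hkert hgt hst (hαbdd t ht).2 h)
end
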